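/- arXiv:1107.2871 — 12 statements merged into one kernel-verified Lean document; each statement's English description precedes it below -/
import Mathlib

section
/- (Theorem 4.1, augmented Skorohod characterization of the derivative of the oblique reflection map.) Under the stated hypotheses, the quadruple (z, y, a, b) solves the augmented Skorohod problem associated with (R, R) for (x, tE); explicitly: (i) a^j(t) = t e_j − R b^j(t) for all j and t ≥ 0; (ii) b(0) = 0 and every entry b_i^j is nonnegative, nondecreasing in t, and right-continuous with left limits on (0,∞); (iii) every entry a_i^j is nonnegative and right-continuous with left limits on (0,∞); (iv) for every i, j, b_i^j(v) = b_i^j(u) whenever 0 ≤ u ≤ v and z_i(s) > 0 for all s ∈ [u,v] (the complementarity condition ∫ z db^j = 0); (v) for every i and every t ≥ 0, z_i(t) = 0 implies a_i^j(t) = 0 for all j. -/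
open Set Filter

/-- `(y, z)` solves the Skorohod problem for `x` with reflection matrix `R`:
`z = x + Ry ≥ 0` on `[0,∞)`, `y(0) = 0`, `y` is componentwise nondecreasing, and each `y_i`
is constant on every interval on which `z_i` is strictly positive. -/
def SolvesSkorohod (J : ℕ) (R : Matrix (Fin J) (Fin J) ℝ)
    (x y z : ℝ → Fin J → ℝ) : Prop :=
  (∀ i, ContinuousOn (fun t => y t i) (Set.Ici 0)) ∧
  (∀ i, ContinuousOn (fun t => z t i) (Set.Ici 0)) ∧
  (∀ t ≥ (0 : ℝ), ∀ i, z t i = x t i + ∑ k, R i k * y t k) ∧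
  (∀ t ≥ (0 : ℝ), ∀ i, 0 ≤ z t i) ∧
  (∀ i, y 0 i = 0) ∧
  (∀ i, ∀ s t : ℝ, 0 ≤ s → s ≤ t → y s i ≤ y t i) ∧
  (∀ i, ∀ u v : ℝ, 0 ≤ u → u ≤ v → (∀ s ∈ Set.Icc u v, 0 < z s i) → y v i = y u i)

open Topology

section SpectralRadius

variable {n : Type*} [Fintype n] [DecidableEq n]

/-- The powers of a real matrix whose complex eigenvalues lie in the open unit disc tend to `0`. -/
theorem Matrix.tendsto_pow_zero_of_spectrum {P : Matrix n n ℝ}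
    (hP : ∀ μ ∈ spectrum ℂ (P.map (Complex.ofReal ·)), ‖μ‖ < 1) (i k : n) :
    Tendsto (fun m : ℕ => (P ^ m) i k) atTop (𝓝 0) := by
  let _ : NormedRing (Matrix n n ℂ) := Matrix.linftyOpNormedRing
  let _ : NormedAlgebra ℂ (Matrix n n ℂ) := Matrix.linftyOpNormedAlgebra
  have : Nonempty n := ⟨i⟩
  have : CompleteSpace (Matrix n n ℂ) := FiniteDimensional.complete ℂ _
  set A : Matrix n n ℂ := P.map (Complex.ofReal ·) with hA
  have hrad : spectralRadius ℂ A < (1 : NNReal) :=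
    spectrum.spectralRadius_lt_of_forall_lt A fun μ hμ => hP μ hμ
  obtain ⟨r, hAr, hr1⟩ := ENNReal.lt_iff_exists_nnreal_btwn.1 hrad
  have hr1 : r < 1 := by exact_mod_cast hr1
  have hle : ∀ᶠ m : ℕ in atTop, ‖(P ^ m) i k‖ ≤ (r : ℝ) ^ m := by
    filter_upwards [(spectrum.pow_nnnorm_pow_one_div_tendsto_nhds_spectralRadius A).eventually
      (gt_mem_nhds hAr), eventually_gt_atTop 0] with m hm hm0
    have hpow : ‖A ^ m‖₊ ≤ r ^ m := by
      have h := ENNReal.rpow_le_rpow hm.le (Nat.cast_nonneg m : (0 : ℝ) ≤ m)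
      rw [← ENNReal.rpow_mul, one_div_mul_cancel (by positivity), ENNReal.rpow_one,
        ENNReal.rpow_natCast] at h
      exact_mod_cast h
    have hentry : ‖(A ^ m) i k‖₊ ≤ ‖A ^ m‖₊ := by
      rw [Matrix.linfty_opNNNorm_def]
      exact (Finset.single_le_sum (f := fun l => ‖(A ^ m) i l‖₊) (fun _ _ => zero_le)
        (Finset.mem_univ k)).trans
          (Finset.le_sup (f := fun i => ∑ l, ‖(A ^ m) i l‖₊) (Finset.mem_univ i))
    have hmap : (A ^ m) i k = ((P ^ m) i k : ℂ) := by
      have h := Matrix.map_pow P Complex.ofRealHom m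
      exact (congrFun (congrFun h i) k).symm
    have h := hentry.trans hpow
    rw [hmap] at h
    have h' : ‖((P ^ m) i k : ℂ)‖ ≤ (r : ℝ) ^ m := by exact_mod_cast h
    rwa [Complex.norm_real] at h'
  exact squeeze_zero_norm' hle
    (tendsto_pow_atTop_nhds_zero_of_lt_one r.2 (by exact_mod_cast hr1))

/-- A vector dominated by its image under a nonnegative matrix of spectral radius less than one
is nonpositive. -/
theorem Matrix.nonpos_of_le_mulVec {P : Matrix n n ℝ} (hnn : ∀ i k, 0 ≤ P i k)
    (hP : ∀ μ ∈ spectrum ℂ (P.map (Complex.ofReal ·)), ‖μ‖ < 1) {D : n → ℝ}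
    (hD : ∀ i, D i ≤ ∑ k, P i k * D k) (i : n) : D i ≤ 0 := by
  have hpow : ∀ m : ℕ, ∀ i, D i ≤ ∑ k, (P ^ m) i k * D k := by
    intro m
    induction m with
    | zero => intro i; simp [Matrix.one_apply]
    | succ m ih =>
      intro i
      calc D i ≤ ∑ k, P i k * D k := hD i
        _ ≤ ∑ k, P i k * ∑ l, (P ^ m) k l * D l :=
          Finset.sum_le_sum fun k _ => mul_le_mul_of_nonneg_left (ih k) (hnn i k)
        _ = ∑ l, (P ^ (m + 1)) i l * D l := by
          simp only [pow_succ', Matrix.mul_apply, Finset.mul_sum, Finset.sum_mul]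
          rw [Finset.sum_comm]
          simp only [mul_assoc]
  have hlim : Tendsto (fun m : ℕ => ∑ k, (P ^ m) i k * D k) atTop (𝓝 (∑ k, 0 * D k)) :=
    tendsto_finsetSum _ fun k _ => (Matrix.tendsto_pow_zero_of_spectrum hP i k).mul_const _
  simpa using ge_of_tendsto' hlim fun m => hpow m i

/-- A family of vectors, bounded above, each of whose positive entries is dominated by the image
of a member of the family under a nonnegative matrix of spectral radius less than one,
is nonpositive. -/
theorem Matrix.family_nonpos_of_le_mulVec {P : Matrix n n ℝ} (hnn : ∀ i k, 0 ≤ P i k)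
    (hP : ∀ μ ∈ spectrum ℂ (P.map (Complex.ofReal ·)), ‖μ‖ < 1)
    {ι : Type*} {g : ι → n → ℝ} (hbdd : ∀ i, BddAbove (range fun p => g p i))
    (hg : ∀ p i, g p i ≤ 0 ∨ ∃ q, g p i ≤ ∑ k, P i k * g q k) (p : ι) (i : n) : g p i ≤ 0 := by
  have : Nonempty ι := ⟨p⟩
  set D : n → ℝ := fun i => max 0 (⨆ p, g p i) with hDdef
  have hgD : ∀ p i, g p i ≤ D i := fun p i => (le_ciSup (hbdd i) p).trans (le_max_right _ _)
  have hPD : ∀ i, 0 ≤ ∑ k, P i k * D k := fun i =>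
    Finset.sum_nonneg fun k _ => mul_nonneg (hnn i k) (le_max_left _ _)
  refine (hgD p i).trans (Matrix.nonpos_of_le_mulVec hnn hP (fun i => ?_) i)
  refine max_le (hPD i) (ciSup_le fun p => ?_)
  obtain h | ⟨q, hq⟩ := hg p i
  · exact h.trans (hPD i)
  · exact hq.trans (Finset.sum_le_sum fun k _ => mul_le_mul_of_nonneg_left (hgD q k) (hnn i k))

end SpectralRadius

theorem Matrix.sum_one_sub_mul {n : Type*} [Fintype n] [DecidableEq n] (P : Matrix n n ℝ)
    (w : n → ℝ) (i : n) : ∑ k, (1 - P) i k * w k = w i - ∑ k, P i k * w k := by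
  simp [Matrix.one_apply, sub_mul, Finset.sum_sub_distrib]

/-- If `y` is constant on the intervals where `z` is positive, then either `z` is positive on
`[s, t]`, or `y` is constant from the last zero of `z` in `[s, t]` on. -/
theorem pos_or_exists_last_zero {y z : ℝ → ℝ} (hy : ContinuousOn y (Ici 0))
    (hz : ContinuousOn z (Ici 0)) (hz0 : ∀ t ≥ 0, 0 ≤ z t)
    (hyz : ∀ u v : ℝ, 0 ≤ u → u ≤ v → (∀ s ∈ Icc u v, 0 < z s) → y v = y u)
    {s t : ℝ} (hs : 0 ≤ s) :
    (∀ r ∈ Icc s t, 0 < z r) ∨ ∃ r ∈ Icc s t, z r = 0 ∧ y t = y r := by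
  by_cases hpos : ∀ r ∈ Icc s t, 0 < z r
  · exact Or.inl hpos
  right
  push Not at hpos
  obtain ⟨r₀, hr₀, hzr₀⟩ := hpos
  have hsub : Icc s t ⊆ Ici 0 := fun r hr => hs.trans hr.1
  have hcomp : IsCompact (Icc s t ∩ z ⁻¹' {0}) :=
    isCompact_Icc.of_isClosed_subset
      ((hz.mono hsub).preimage_isClosed_of_isClosed isClosed_Icc isClosed_singleton)
      inter_subset_left
  obtain ⟨r, ⟨hr, hzr⟩, hmax⟩ := hcomp.exists_isGreatest
    ⟨r₀, hr₀, le_antisymm hzr₀ (hz0 _ (hsub hr₀))⟩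
  refine ⟨r, hr, hzr, ?_⟩
  rcases hr.2.eq_or_lt with rfl | hrt
  · rfl
  have hconst : ∀ᶠ q in 𝓝[>] r, y q = y t := by
    filter_upwards [Ioc_mem_nhdsGT hrt] with q hq
    refine (hyz q t (hsub ⟨hr.1.trans hq.1.le, hq.2⟩) hq.2 fun p hp => ?_).symm
    have hp' : p ∈ Icc s t := ⟨hr.1.trans (hq.1.le.trans hp.1), hp.2⟩
    refine (hz0 p (hsub hp')).lt_of_ne fun h => ?_
    exact (hq.1.trans_le hp.1).not_ge (hmax ⟨hp', h.symm⟩)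
  have hlim : Tendsto y (𝓝[>] r) (𝓝 (y r)) :=
    (hy r (hsub hr)).mono_left (nhdsWithin_mono r fun q hq =>
      mem_Ici.2 ((mem_Ici.1 (hsub hr)).trans (mem_Ioi.1 hq).le))
  exact tendsto_nhds_unique (tendsto_const_nhds.congr' (hconst.mono fun q hq => hq.symm)) hlim

namespace SolvesSkorohod

variable {J : ℕ} {P R : Matrix (Fin J) (Fin J) ℝ} {x x' y y' z z' : ℝ → Fin J → ℝ}

theorem eq_sub (h : SolvesSkorohod J (1 - P) x y z) {t : ℝ} (ht : 0 ≤ t) (i : Fin J) :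
    z t i = x t i + (y t i - ∑ k, P i k * y t k) := by
  rw [h.2.2.1 t ht i, Matrix.sum_one_sub_mul]

theorem pos_or_last_zero (h : SolvesSkorohod J R x y z) (i : Fin J) {s t : ℝ} (hs : 0 ≤ s) :
    (∀ r ∈ Icc s t, 0 < z r i) ∨ ∃ r ∈ Icc s t, z r i = 0 ∧ y t i = y r i :=
  pos_or_exists_last_zero (y := fun t => y t i) (z := fun t => z t i) (h.1 i) (h.2.1 i)
    (fun t ht => h.2.2.2.1 t ht i) (h.2.2.2.2.2.2 i) hs

/-- The regulator is constant from some point of `[0, t]` on, which is `0` or a zero of `z`. -/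
theorem exists_eq_zero_or (h : SolvesSkorohod J R x y z) (i : Fin J) {t : ℝ} (ht : 0 ≤ t) :
    ∃ r, 0 ≤ r ∧ r ≤ t ∧ y t i = y r i ∧ (r = 0 ∨ z r i = 0) := by
  rcases h.pos_or_last_zero i (t := t) le_rfl with hpos | ⟨r, hr, hz, hy⟩
  · exact ⟨0, le_rfl, ht, h.2.2.2.2.2.2 i 0 t le_rfl ht hpos, Or.inl rfl⟩
  · exact ⟨r, hr.1, hr.2, hy, Or.inr hz⟩

/-- The regulator is the least nonnegative nondecreasing function keeping `x + (1 - P) w`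
nonnegative. -/
theorem le_of_feasible (hnn : ∀ i k, 0 ≤ P i k)
    (hP : ∀ μ ∈ spectrum ℂ (P.map (Complex.ofReal ·)), ‖μ‖ < 1)
    (h : SolvesSkorohod J (1 - P) x y z) {w : ℝ → Fin J → ℝ}
    (hw0 : ∀ i, 0 ≤ w 0 i) (hwmono : ∀ i, ∀ s t : ℝ, 0 ≤ s → s ≤ t → w s i ≤ w t i)
    (hw : ∀ t ≥ (0 : ℝ), ∀ i, 0 ≤ x t i + (w t i - ∑ k, P i k * w t k))
    {t : ℝ} (ht : 0 ≤ t) (i : Fin J) : y t i ≤ w t i := by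
  have key := Matrix.family_nonpos_of_le_mulVec hnn hP (ι := Icc (0 : ℝ) t)
    (g := fun p i => y p i - w p i) ?_ ?_ ⟨t, ht, le_rfl⟩ i
  · exact sub_nonpos.1 key
  · rintro i
    refine ⟨y t i, ?_⟩
    rintro _ ⟨⟨p, hp⟩, rfl⟩
    have h1 := h.2.2.2.2.2.1 i p t hp.1 hp.2
    have h2 := (hw0 i).trans (hwmono i 0 p le_rfl hp.1)
    dsimp only
    linarith
  · rintro ⟨p, hp⟩ i
    obtain ⟨r, hr0, hrp, hyr, hr⟩ := h.exists_eq_zero_or i hp.1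
    have hwr := hwmono i r p hr0 hrp
    dsimp only
    rcases hr with rfl | hzr
    · left
      have h1 := h.2.2.2.2.1 i
      have h2 := hw0 i
      linarith
    · right
      refine ⟨⟨r, hr0, hrp.trans hp.2⟩, ?_⟩
      have h1 := h.eq_sub hr0 i
      have h2 := hw r hr0 i
      simp only [mul_sub, Finset.sum_sub_distrib]
      linarith

/-- If `x'` starts below `x`, then the regulator of `x'` is constant from some point of `[0, t]`
on, at which the reflected paths are ordered. -/
theorem exists_eq_and_le (h : SolvesSkorohod J (1 - P) x y z)
    (h' : SolvesSkorohod J (1 - P) x' y' z') (hx0 : ∀ i, x' 0 i ≤ x 0 i) (i : Fin J) {t : ℝ}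
    (ht : 0 ≤ t) : ∃ r, 0 ≤ r ∧ r ≤ t ∧ y' t i = y' r i ∧ z' r i ≤ z r i := by
  obtain ⟨r, hr0, hrt, hyr, hr⟩ := h'.exists_eq_zero_or i ht
  refine ⟨r, hr0, hrt, hyr, ?_⟩
  rcases hr with rfl | hr
  · have e := h.eq_sub le_rfl i
    have e' := h'.eq_sub le_rfl i
    simp only [h.2.2.2.2.1, h'.2.2.2.2.1, mul_zero, Finset.sum_const_zero] at e e'
    linarith [hx0 i]
  · rw [hr]; exact h.2.2.2.1 r hr0 i

/-- Lowering the input by a nonnegative nondecreasing function raises the increments of the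
regulator. -/
theorem increment_le (hnn : ∀ i k, 0 ≤ P i k)
    (hP : ∀ μ ∈ spectrum ℂ (P.map (Complex.ofReal ·)), ‖μ‖ < 1)
    (h : SolvesSkorohod J (1 - P) x y z) (h' : SolvesSkorohod J (1 - P) x' y' z')
    (hx0 : ∀ i, x' 0 i ≤ x 0 i)
    (hx : ∀ i, ∀ s t : ℝ, 0 ≤ s → s ≤ t → x s i - x' s i ≤ x t i - x' t i)
    {s t : ℝ} (hs : 0 ≤ s) (hst : s ≤ t) (i : Fin J) : y t i - y s i ≤ y' t i - y' s i := by
  have key := Matrix.family_nonpos_of_le_mulVec hnn hP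
    (ι := {p : ℝ × ℝ // 0 ≤ p.1 ∧ p.1 ≤ p.2 ∧ p.2 ≤ t})
    (g := fun p i => (y p.1.2 i - y p.1.1 i) - (y' p.1.2 i - y' p.1.1 i))
    ?_ ?_ ⟨(s, t), hs, hst, le_rfl⟩ i
  · exact sub_nonpos.1 key
  · rintro i
    refine ⟨y t i, ?_⟩
    rintro _ ⟨⟨⟨u, v⟩, hu, huv, hv⟩, rfl⟩
    dsimp only at hu huv hv ⊢
    have h1 := h.2.2.2.2.2.1 i v t (hu.trans huv) hv
    have h2 := h.2.2.2.2.2.1 i 0 u le_rfl hu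
    have h3 := h.2.2.2.2.1 i
    have h4 := h'.2.2.2.2.2.1 i u v hu huv
    linarith
  · rintro ⟨⟨u, v⟩, hu, huv, hv⟩ i
    dsimp only at hu huv hv ⊢
    rcases h.pos_or_last_zero i (t := v) hu with hpos | ⟨q, hq, hzq, hyq⟩
    · left
      have h1 := h.2.2.2.2.2.2 i u v hu huv hpos
      have h2 := h'.2.2.2.2.2.1 i u v hu huv
      linarith
    right
    obtain ⟨r, hr0, hru, hyr, hz⟩ := exists_eq_and_le h h' hx0 i hu
    have hrq : r ≤ q := hru.trans hq.1
    have hq0 : 0 ≤ q := hu.trans hq.1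
    refine ⟨⟨(r, q), hr0, hrq, hq.2.trans hv⟩, ?_⟩
    have e1 := h.eq_sub hq0 i
    have e2 := h.eq_sub hr0 i
    have e3 := h'.eq_sub hq0 i
    have e4 := h'.eq_sub hr0 i
    have e5 := h'.2.2.2.1 q hq0 i
    have e6 := hx i r q hr0 hrq
    have e7 := h'.2.2.2.2.2.1 i q v hq0 hq.2
    have e8 := h.2.2.2.2.2.1 i r u hr0 hru
    simp only [mul_sub, Finset.sum_sub_distrib]
    linarith

/-- Lowering the input by a nonnegative nondecreasing function lowers the reflected path. -/
theorem reflected_le (hnn : ∀ i k, 0 ≤ P i k)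
    (hP : ∀ μ ∈ spectrum ℂ (P.map (Complex.ofReal ·)), ‖μ‖ < 1)
    (h : SolvesSkorohod J (1 - P) x y z) (h' : SolvesSkorohod J (1 - P) x' y' z')
    (hx0 : ∀ i, x' 0 i ≤ x 0 i)
    (hx : ∀ i, ∀ s t : ℝ, 0 ≤ s → s ≤ t → x s i - x' s i ≤ x t i - x' t i)
    {t : ℝ} (ht : 0 ≤ t) (i : Fin J) : z' t i ≤ z t i := by
  obtain ⟨r, hr0, hrt, hyr, hz⟩ := exists_eq_and_le h h' hx0 i ht
  have hsum : ∑ k, P i k * (y t k - y r k) ≤ ∑ k, P i k * (y' t k - y' r k) :=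
    Finset.sum_le_sum fun k _ =>
      mul_le_mul_of_nonneg_left (increment_le hnn hP h h' hx0 hx hr0 hrt k) (hnn i k)
  simp only [mul_sub, Finset.sum_sub_distrib] at hsum
  linarith [h.eq_sub ht i, h.eq_sub hr0 i, h'.eq_sub ht i, h'.eq_sub hr0 i, hx i r t hr0 hrt,
    h.2.2.2.2.2.1 i r t hr0 hrt]

end SolvesSkorohod

/-- A nondecreasing function on `[0, ∞)` that is the limit from above of nondecreasing
functions continuous at `t` is right-continuous at `t`. -/
theorem continuousWithinAt_Ici_of_monotone_of_approx {b : ℝ → ℝ} {t : ℝ}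
    (hmono : ∀ s ≥ t, b t ≤ b s)
    (happrox : ∀ c > b t, ∃ f : ℝ → ℝ, ContinuousWithinAt f (Ici t) t ∧ f t < c ∧
      ∀ s ≥ t, b s ≤ f s) : ContinuousWithinAt b (Ici t) t := by
  refine tendsto_order.2 ⟨fun c hc => ?_, fun c hc => ?_⟩
  · filter_upwards [self_mem_nhdsWithin] with s hs using hc.trans_le (hmono s hs)
  · obtain ⟨f, hf, hft, hbf⟩ := happrox c hc
    filter_upwards [hf.eventually (gt_mem_nhds hft), self_mem_nhdsWithin] with s hs hst
    exact (hbf s hst).trans_lt hs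

/-- A function which is nondecreasing on `[0, ∞)` has left limits on `(0, ∞)`. -/
theorem exists_leftLim_of_monotone {b : ℝ → ℝ}
    (hmono : ∀ s t : ℝ, 0 ≤ s → s ≤ t → b s ≤ b t) {t : ℝ} (ht : 0 < t) :
    ∃ l : ℝ, Tendsto b (𝓝[<] t) (𝓝 l) := by
  have hm : MonotoneOn b (Ioo 0 t) := fun s hs r _ hsr => hmono s r hs.1.le hsr
  have hb : BddAbove (b '' Ioo 0 t) := by
    refine ⟨b t, ?_⟩
    rintro _ ⟨s, hs, rfl⟩
    exact hmono s t hs.1.le hs.2.le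
  have h := hm.tendsto_nhdsWithin_Ioo_left (nonempty_Ioo.2 ht) hb
  exact ⟨_, h⟩

/-- (Theorem 4.1: augmented Skorohod characterization of the derivative of the oblique
reflection map.)  `P` is a nonnegative `J×J` matrix with zero diagonal and spectral radius
less than one, `R = E − P`; `(y,z)` solves the Skorohod problem for the continuous `x`,
`(y^{ε,j}, z^{ε,j})` solves it for `t ↦ x(t) − ε t e_j`, and `a_i^j(t)`, `b_i^j(t)` are the
left derivatives `lim_{ε→0+} (z_i(t) − z_i^{ε,j}(t))/ε` and `−lim_{ε→0+} (y_i(t) − y_i^{ε,j}(t))/ε`.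
Then `(z, y, a, b)` solves the augmented Skorohod problem associated with `(R,R)` for `(x, tE)`:
(i) `a^j(t) = t e_j − R b^j(t)`; (ii) `b(0) = 0`, `b` is entrywise nonnegative, nondecreasing,
right-continuous with left limits on `(0,∞)`; (iii) `a` is entrywise nonnegative and
right-continuous with left limits on `(0,∞)`; (iv) each `b_i^j` is constant on intervals where
`z_i > 0`; (v) `z_i(t) = 0` implies `a_i^j(t) = 0` for all `j`. -/
theorem augmented_skorohod_characterization
    (J : ℕ) (P : Matrix (Fin J) (Fin J) ℝ)
    (hPnn : ∀ i k, 0 ≤ P i k) (hPdiag : ∀ i, P i i = 0)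
    (hPspec : ∀ μ ∈ spectrum ℂ (P.map (Complex.ofReal ·)), ‖μ‖ < 1)
    (R : Matrix (Fin J) (Fin J) ℝ) (hR : R = 1 - P)
    (x y z : ℝ → Fin J → ℝ) (hx : ∀ i, ContinuousOn (fun t => x t i) (Set.Ici 0))
    (hxyz : SolvesSkorohod J R x y z)
    (yE zE : ℝ → Fin J → ℝ → Fin J → ℝ)
    (hE : ∀ ε > (0 : ℝ), ∀ j : Fin J,
      SolvesSkorohod J R (fun t i => x t i - ε * t * (if i = j then 1 else 0))
        (yE ε j) (zE ε j))
    (a b : ℝ → Fin J → Fin J → ℝ)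
    (ha : ∀ (i j : Fin J), ∀ t ≥ (0 : ℝ),
      Filter.Tendsto (fun ε => (z t i - zE ε j t i) / ε)
        (nhdsWithin 0 (Set.Ioi 0)) (nhds (a t i j)))
    (hb : ∀ (i j : Fin J), ∀ t ≥ (0 : ℝ),
      Filter.Tendsto (fun ε => -((y t i - yE ε j t i) / ε))
        (nhdsWithin 0 (Set.Ioi 0)) (nhds (b t i j))) :
    -- (i)
    (∀ (j : Fin J), ∀ t ≥ (0 : ℝ), ∀ i,
      a t i j = t * (if i = j then 1 else 0) - ∑ k, R i k * b t k j) ∧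
    -- (ii)
    (∀ i j, b 0 i j = 0) ∧
    (∀ i j, ∀ t ≥ (0 : ℝ), 0 ≤ b t i j) ∧
    (∀ i j, ∀ s t : ℝ, 0 ≤ s → s ≤ t → b s i j ≤ b t i j) ∧
    (∀ i j, ∀ t ≥ (0 : ℝ), ContinuousWithinAt (fun s => b s i j) (Set.Ici t) t) ∧
    (∀ i j, ∀ t > (0 : ℝ), ∃ l : ℝ,
      Filter.Tendsto (fun s => b s i j) (nhdsWithin t (Set.Iio t)) (nhds l)) ∧
    -- (iii)
    (∀ i j, ∀ t ≥ (0 : ℝ), 0 ≤ a t i j) ∧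
    (∀ i j, ∀ t ≥ (0 : ℝ), ContinuousWithinAt (fun s => a s i j) (Set.Ici t) t) ∧
    (∀ i j, ∀ t > (0 : ℝ), ∃ l : ℝ,
      Filter.Tendsto (fun s => a s i j) (nhdsWithin t (Set.Iio t)) (nhds l)) ∧
    -- (iv)
    (∀ i j, ∀ u v : ℝ, 0 ≤ u → u ≤ v →
      (∀ s ∈ Set.Icc u v, 0 < z s i) → b v i j = b u i j) ∧
    -- (v)
    (∀ i, ∀ t ≥ (0 : ℝ), z t i = 0 → ∀ j, a t i j = 0) := by
  subst hR
  have hsub : ∀ ε > (0 : ℝ), ∀ (j : Fin J) (i : Fin J) (s t : ℝ), 0 ≤ s → s ≤ t →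
      x s i - (x s i - ε * s * (if i = j then 1 else 0)) ≤
        x t i - (x t i - ε * t * (if i = j then 1 else 0)) := by
    intro ε hε j i s t _ hst
    split_ifs
    · have := mul_le_mul_of_nonneg_left hst hε.le
      linarith
    · simp
  have hsub0 : ∀ (ε : ℝ) (j i : Fin J),
      x 0 i - ε * 0 * (if i = j then 1 else 0) ≤ x 0 i := by simp
  -- monotonicity and convexity of the perturbed regulators
  have hinc : ∀ ε > (0 : ℝ), ∀ (j i : Fin J) (s t : ℝ), 0 ≤ s → s ≤ t →
      y t i - y s i ≤ yE ε j t i - yE ε j s i := fun ε hε j i s t hs hst =>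
    SolvesSkorohod.increment_le hPnn hPspec hxyz (hE ε hε j) (hsub0 ε j) (hsub ε hε j) hs hst i
  have hzle : ∀ ε > (0 : ℝ), ∀ (j i : Fin J) (t : ℝ), 0 ≤ t → zE ε j t i ≤ z t i :=
    fun ε hε j i t ht =>
      SolvesSkorohod.reflected_le hPnn hPspec hxyz (hE ε hε j) (hsub0 ε j) (hsub ε hε j) ht i
  have hconv : ∀ ε > (0 : ℝ), ∀ δ > (0 : ℝ), δ ≤ ε → ∀ (j i : Fin J) (t : ℝ), 0 ≤ t →
      yE δ j t i ≤ y t i + δ / ε * (yE ε j t i - y t i) := by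
    intro ε hε δ hδ hδε j i t ht
    have hl0 : 0 ≤ δ / ε := by positivity
    have hl1 : δ / ε ≤ 1 := (div_le_one hε).2 hδε
    refine SolvesSkorohod.le_of_feasible hPnn hPspec (hE δ hδ j)
      (w := fun t i => y t i + δ / ε * (yE ε j t i - y t i)) ?_ ?_ ?_ ht i
    · intro i
      simp [hxyz.2.2.2.2.1 i, (hE ε hε j).2.2.2.2.1 i]
    · intro i s t hs hst
      have h1 := hxyz.2.2.2.2.2.1 i s t hs hst
      have h2 := mul_le_mul_of_nonneg_left (hinc ε hε j i s t hs hst) hl0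
      have h3 := mul_nonneg hl0 (sub_nonneg.2 h1)
      linarith
    · intro t ht i
      have e1 := hxyz.eq_sub ht i
      have e2 := (hE ε hε j).eq_sub ht i
      have h1 := hxyz.2.2.2.1 t ht i
      have h2 := (hE ε hε j).2.2.2.1 t ht i
      have hz : 0 ≤ (1 - δ / ε) * z t i + δ / ε * zE ε j t i :=
        add_nonneg (mul_nonneg (sub_nonneg.2 hl1) h1) (mul_nonneg hl0 h2)
      refine hz.trans_eq ?_
      have hδ' : δ / ε * ε = δ := div_mul_cancel₀ δ hε.ne'
      have hs : ∑ k, P i k * (y t k + δ / ε * (yE ε j t k - y t k)) =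
          (1 - δ / ε) * ∑ k, P i k * y t k + δ / ε * ∑ k, P i k * yE ε j t k := by
        simp only [Finset.mul_sum, ← Finset.sum_add_distrib]
        exact Finset.sum_congr rfl fun k _ => by ring
      rw [e1, e2, hs]
      linear_combination -t * (if i = j then 1 else 0) * hδ'
  have hpos : ∀ᶠ ε : ℝ in 𝓝[>] 0, 0 < ε := self_mem_nhdsWithin
  have hcancel : ∀ t, ∀ i j, ∀ ε : ℝ,
      -((y t i - yE ε j t i) / ε) = (yE ε j t i - y t i) / ε := fun t i j ε => by ring
  have hble : ∀ ε > (0 : ℝ), ∀ (i j : Fin J) (t : ℝ), 0 ≤ t →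
      b t i j ≤ (yE ε j t i - y t i) / ε := by
    intro ε hε i j t ht
    refine le_of_tendsto (hb i j t ht) ?_
    filter_upwards [hpos, Ioc_mem_nhdsGT hε] with δ hδ hδε
    rw [hcancel, div_le_iff₀ hδ]
    have h := hconv ε hε δ hδ hδε.2 j i t ht
    calc yE δ j t i - y t i ≤ δ / ε * (yE ε j t i - y t i) := by linarith
      _ = (yE ε j t i - y t i) / ε * δ := by ring
  -- the properties of `a` and `b`
  have hi : ∀ (j : Fin J), ∀ t ≥ (0 : ℝ), ∀ i,
      a t i j = t * (if i = j then 1 else 0) - ∑ k, (1 - P) i k * b t k j := by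
    intro j t ht i
    have hlim : Tendsto (fun ε => t * (if i = j then (1 : ℝ) else 0) -
        ∑ k, (1 - P) i k * -((y t k - yE ε j t k) / ε)) (𝓝[>] 0)
        (𝓝 (t * (if i = j then 1 else 0) - ∑ k, (1 - P) i k * b t k j)) :=
      tendsto_const_nhds.sub (tendsto_finsetSum _ fun k _ => (hb k j t ht).const_mul _)
    refine tendsto_nhds_unique (ha i j t ht) (hlim.congr' ?_)
    filter_upwards [hpos] with ε hε
    rw [hxyz.2.2.1 t ht i, (hE ε hε j).2.2.1 t ht i, eq_div_iff hε.ne', sub_mul, Finset.sum_mul]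
    have hs : ∑ k, (1 - P) i k * -((y t k - yE ε j t k) / ε) * ε =
        ∑ k, (1 - P) i k * yE ε j t k - ∑ k, (1 - P) i k * y t k := by
      rw [← Finset.sum_sub_distrib]
      refine Finset.sum_congr rfl fun k _ => ?_
      field_simp
      ring
    rw [hs]
    ring
  have hb0 : ∀ i j, b 0 i j = 0 := by
    intro i j
    refine tendsto_nhds_unique (hb i j 0 le_rfl) (tendsto_const_nhds.congr' ?_)
    filter_upwards [hpos] with ε hε
    simp [hxyz.2.2.2.2.1 i, (hE ε hε j).2.2.2.2.1 i]
  have hbmono : ∀ i j, ∀ s t : ℝ, 0 ≤ s → s ≤ t → b s i j ≤ b t i j := by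
    intro i j s t hs hst
    refine le_of_tendsto_of_tendsto (hb i j s hs) (hb i j t (hs.trans hst)) ?_
    filter_upwards [hpos] with ε hε
    rw [hcancel, hcancel]
    refine div_le_div_of_nonneg_right ?_ hε.le
    linarith [hinc ε hε j i s t hs hst]
  have hbrc : ∀ i j, ∀ t ≥ (0 : ℝ), ContinuousWithinAt (fun s => b s i j) (Ici t) t := by
    intro i j t ht
    refine continuousWithinAt_Ici_of_monotone_of_approx (fun s hs => hbmono i j t s ht hs)
      fun c hc => ?_
    obtain ⟨ε, hεc, hε⟩ := (((hb i j t ht).eventually (gt_mem_nhds hc)).and hpos).exists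
    refine ⟨fun s => (yE ε j s i - y s i) / ε, ?_, by rwa [hcancel] at hεc,
      fun s hs => hble ε hε i j s (ht.trans hs)⟩
    exact ((((hE ε hε j).1 i t ht).sub (hxyz.1 i t ht)).div_const ε).mono
      (Ici_subset_Ici.2 ht)
  have hbll : ∀ i j, ∀ t > (0 : ℝ), ∃ l : ℝ, Tendsto (fun s => b s i j) (𝓝[<] t) (𝓝 l) :=
    fun i j t ht => exists_leftLim_of_monotone (hbmono i j) ht
  refine ⟨hi, hb0, fun i j t ht => (hb0 i j).symm.le.trans (hbmono i j 0 t le_rfl ht), hbmono,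
    hbrc, hbll, ?_, ?_, ?_, ?_, ?_⟩
  · intro i j t ht
    refine ge_of_tendsto (ha i j t ht) ?_
    filter_upwards [hpos] with ε hε
    exact div_nonneg (sub_nonneg.2 (hzle ε hε j i t ht)) hε.le
  · intro i j t ht
    have hcont : ContinuousWithinAt (fun s => s * (if i = j then (1 : ℝ) else 0) -
        ∑ k, (1 - P) i k * b s k j) (Ici t) t :=
      (continuousWithinAt_id.mul continuousWithinAt_const).sub
        (tendsto_finsetSum _ fun k _ => (hbrc k j t ht).const_mul _)
    exact hcont.congr (fun s hs => hi j s (ht.trans hs) i) (hi j t ht i)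
  · intro i j t ht
    choose l hl using fun k => hbll k j t ht
    refine ⟨t * (if i = j then 1 else 0) - ∑ k, (1 - P) i k * l k, ?_⟩
    have hlim : Tendsto (fun s => s * (if i = j then (1 : ℝ) else 0) -
        ∑ k, (1 - P) i k * b s k j) (𝓝[<] t)
        (𝓝 (t * (if i = j then 1 else 0) - ∑ k, (1 - P) i k * l k)) :=
      ((tendsto_nhdsWithin_of_tendsto_nhds tendsto_id).mul_const _).sub
        (tendsto_finsetSum _ fun k _ => (hl k).const_mul _)
    refine hlim.congr' ?_
    filter_upwards [Ioo_mem_nhdsLT ht] with s hs using (hi j s hs.1.le i).symm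
  · intro i j u v hu huv hz
    have hv : 0 ≤ v := hu.trans huv
    obtain ⟨m, hm, hmin⟩ := isCompact_Icc.exists_isMinOn (nonempty_Icc.2 huv)
      ((hxyz.2.1 i).mono fun s hs => hu.trans hs.1)
    have hlim : Tendsto (fun ε => ε * v + ε * ∑ k, P i k * -((y v k - yE ε j v k) / ε)) (𝓝[>] 0)
        (𝓝 (0 * v + 0 * ∑ k, P i k * b v k j)) := by
      have hid : Tendsto (fun ε : ℝ => ε) (𝓝[>] 0) (𝓝 0) :=
        tendsto_nhdsWithin_of_tendsto_nhds tendsto_id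
      exact (hid.mul_const _).add
        (hid.mul (tendsto_finsetSum _ fun k _ => (hb k j v hv).const_mul _))
    simp only [zero_mul, add_zero] at hlim
    refine tendsto_nhds_unique (hb i j v hv) ((hb i j u hu).congr' ?_)
    filter_upwards [hpos, hlim.eventually (gt_mem_nhds (hz m hm))] with ε hε hsmall
    have hzE : ∀ s ∈ Icc u v, 0 < zE ε j s i := by
      intro s hs
      have hs0 : 0 ≤ s := hu.trans hs.1
      have hms : z m i ≤ z s i := hmin hs
      have e1 := hxyz.eq_sub hs0 i
      have e2 := (hE ε hε j).eq_sub hs0 i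
      have hdiff : ∀ k, 0 ≤ yE ε j s k - y s k := fun k => by
        have h := hinc ε hε j k 0 s le_rfl hs0
        rw [hxyz.2.2.2.2.1 k, (hE ε hε j).2.2.2.2.1 k] at h
        linarith
      have hsum : ∑ k, P i k * (yE ε j s k - y s k) ≤
          ε * ∑ k, P i k * -((y v k - yE ε j v k) / ε) := by
        rw [Finset.mul_sum]
        refine Finset.sum_le_sum fun k _ => ?_
        have h := hinc ε hε j k s v hs0 hs.2
        calc P i k * (yE ε j s k - y s k) ≤ P i k * (yE ε j v k - y v k) :=
              mul_le_mul_of_nonneg_left (by linarith) (hPnn i k)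
          _ = ε * (P i k * -((y v k - yE ε j v k) / ε)) := by field_simp; ring
      simp only [mul_sub, Finset.sum_sub_distrib] at hsum
      have hεs : ε * s * (if i = j then 1 else 0) ≤ ε * v := by
        have h1 := mul_le_mul_of_nonneg_left hs.2 hε.le
        have h2 : 0 ≤ ε * v := by positivity
        split_ifs <;> linarith
      linarith [hdiff i]
    rw [hxyz.2.2.2.2.2.2 i u v hu huv hz, (hE ε hε j).2.2.2.2.2.2 i u v hu huv hzE]
  · intro i t ht hzt j
    refine tendsto_nhds_unique (ha i j t ht) (tendsto_const_nhds.congr' ?_)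
    filter_upwards [hpos] with ε hε
    have h : zE ε j t i = 0 :=
      le_antisymm ((hzle ε hε j i t ht).trans_eq hzt) ((hE ε hε j).2.2.2.1 t ht i)
    simp [hzt, h]
end

section
/- (Equation (1dlap): the one-dimensional basic adjoint relationship determines the joint Laplace transform.) Let π be a Borel probability measure on [0,∞)² such that for every f ∈ C_b²([0,∞)²): 0 = ∫∫ [ (σ²/2) ∂²f/∂z²(z,a) + θ ∂f/∂z(z,a) + ∂f/∂a(z,a) − ∂f/∂a(0,a) ] dπ(z,a) − θ ∂f/∂z(0,0). Then for all α > 0 and η > 0, ∫∫ e^{−αz−ηa} dπ(z,a) = −2θ / (ασ² − θ + √(2ησ² + θ²)). In particular, at most one Borel probability measure on [0,∞)² satisfies the stated relationship. -/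
open MeasureTheory Set

/-- `f ∈ C_b²([0,∞)²)`: twice continuously differentiable with bounded first- and second-order
derivatives (formalized via a globally `C²` function on `ℝ²` with globally bounded
derivatives). -/
def CbTwo (f : ℝ × ℝ → ℝ) : Prop :=
  ContDiff ℝ 2 f ∧
  ∃ C : ℝ, ∀ p : ℝ × ℝ, ‖fderiv ℝ f p‖ ≤ C ∧ ‖fderiv ℝ (fderiv ℝ f) p‖ ≤ C

/-- The one-dimensional basic adjoint relationship of Theorem 2.1 for a measure `π` on
`[0,∞)²`, for every `f ∈ C_b²([0,∞)²)`:
`0 = ∫∫ [ (σ²/2) ∂²f/∂z² + θ ∂f/∂z + ∂f/∂a(z,a) − ∂f/∂a(0,a) ] dπ(z,a) − θ ∂f/∂z(0,0)`. -/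
def SatisfiesBAR (θ σ : ℝ) (π : Measure (ℝ × ℝ)) : Prop :=
  ∀ f : ℝ × ℝ → ℝ, CbTwo f →
    0 = (∫ p, ((σ ^ 2 / 2) * fderiv ℝ (fun q => fderiv ℝ f q (1, 0)) p (1, 0)
          + θ * fderiv ℝ f p (1, 0)
          + fderiv ℝ f p (0, 1)
          - fderiv ℝ f (0, p.2) (0, 1)) ∂π)
      - θ * fderiv ℝ f (0, 0) (1, 0)

/-- A smooth function on `ℝ` that agrees with `x ↦ e^{-αx}` on a neighbourhood of `[0,∞)` and
vanishes near `-∞`. -/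
noncomputable def expCutoff (α x : ℝ) : ℝ :=
  Real.smoothTransition (x + 2) * Real.exp (-α * x)

lemma contDiff_expCutoff (α : ℝ) (n : ℕ) : ContDiff ℝ n (expCutoff α) := by
  have h : ContDiff ℝ n Real.smoothTransition := Real.smoothTransition.contDiff (n := (n : ℕ∞))
  unfold expCutoff
  exact (h.comp (by fun_prop)).mul (by fun_prop)

lemma iteratedDeriv_expCutoff (α : ℝ) (n : ℕ) {x : ℝ} (hx : -1 < x) :
    iteratedDeriv n (expCutoff α) x = (-α) ^ n * Real.exp (-α * x) := by
  have h : expCutoff α =ᶠ[nhds x] fun y => Real.exp (-α * y) := by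
    filter_upwards [Ioi_mem_nhds hx] with y hy
    have hy : -1 < y := hy
    simp [expCutoff, Real.smoothTransition.one_of_one_le (by linarith : 1 ≤ y + 2)]
  rw [h.iteratedDeriv_eq n, iteratedDeriv_exp_const_mul]

lemma exists_bound_iteratedDeriv_expCutoff {α : ℝ} (hα : 0 ≤ α) (n : ℕ) :
    ∃ C, ∀ x, |iteratedDeriv n (expCutoff α) x| ≤ C := by
  obtain ⟨C, hC⟩ := (isCompact_Icc (a := (-2 : ℝ)) (b := 0)).exists_bound_of_continuousOn
    ((contDiff_expCutoff α n).continuous_iteratedDeriv n le_rfl).continuousOn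
  refine ⟨max C (α ^ n), fun x => ?_⟩
  rcases lt_or_ge x (-2) with hx | hx
  · have h : expCutoff α =ᶠ[nhds x] fun _ => 0 := by
      filter_upwards [Iio_mem_nhds hx] with y hy
      have hy : y < -2 := hy
      simp [expCutoff, Real.smoothTransition.zero_of_nonpos (by linarith : y + 2 ≤ 0)]
    rw [h.iteratedDeriv_eq n]
    simp only [iteratedDeriv_const, ite_self, abs_zero]
    exact le_max_of_le_right (by positivity)
  rcases le_or_gt x 0 with hx' | hx'
  · exact (hC x ⟨hx, hx'⟩).trans (le_max_left _ _)
  · rw [iteratedDeriv_expCutoff α n (by linarith), abs_mul, abs_pow, abs_neg, abs_of_nonneg hα,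
      Real.abs_exp]
    refine le_max_of_le_right (mul_le_of_le_one_right (by positivity) ?_)
    rw [Real.exp_le_one_iff]
    nlinarith

lemma hasFDerivAt_mul_fst_snd {g h : ℝ → ℝ} (hg : Differentiable ℝ g) (hh : Differentiable ℝ h)
    (p : ℝ × ℝ) :
    HasFDerivAt (fun q : ℝ × ℝ => g q.1 * h q.2)
      ((deriv g p.1 * h p.2) • ContinuousLinearMap.fst ℝ ℝ ℝ
        + (g p.1 * deriv h p.2) • ContinuousLinearMap.snd ℝ ℝ ℝ) p := by
  have h1 := (hg p.1).hasDerivAt.comp_hasFDerivAt p (hasFDerivAt_fst (𝕜 := ℝ) (p := p))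
  have h2 := (hh p.2).hasDerivAt.comp_hasFDerivAt p (hasFDerivAt_snd (𝕜 := ℝ) (p := p))
  refine (h1.mul h2).congr_fderiv ?_
  ext <;> simp [mul_comm]

lemma norm_fderiv_mul_fst_snd_le {g h : ℝ → ℝ} (hg : Differentiable ℝ g)
    (hh : Differentiable ℝ h) {A B : ℝ}
    (hgA : ∀ x, |g x| ≤ A) (hgA' : ∀ x, |deriv g x| ≤ A)
    (hhB : ∀ x, |h x| ≤ B) (hhB' : ∀ x, |deriv h x| ≤ B) (p : ℝ × ℝ) :
    ‖fderiv ℝ (fun q : ℝ × ℝ => g q.1 * h q.2) p‖ ≤ 2 * (A * B) := by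
  have hA : 0 ≤ A := (abs_nonneg _).trans (hgA 0)
  rw [(hasFDerivAt_mul_fst_snd hg hh p).fderiv, two_mul]
  refine (norm_add_le _ _).trans (add_le_add ?_ ?_)
  · rw [norm_smul, Real.norm_eq_abs, abs_mul]
    refine (mul_le_of_le_one_right (by positivity) (ContinuousLinearMap.norm_fst_le ..)).trans ?_
    exact mul_le_mul (hgA' _) (hhB _) (abs_nonneg _) hA
  · rw [norm_smul, Real.norm_eq_abs, abs_mul]
    refine (mul_le_of_le_one_right (by positivity) (ContinuousLinearMap.norm_snd_le ..)).trans ?_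
    exact mul_le_mul (hgA _) (hhB' _) (abs_nonneg _) hA

lemma cbTwo_mul_fst_snd {g h : ℝ → ℝ} (hg : ContDiff ℝ 2 g) (hh : ContDiff ℝ 2 h) {A B : ℝ}
    (hgA : ∀ n ≤ 2, ∀ x, |iteratedDeriv n g x| ≤ A)
    (hhB : ∀ n ≤ 2, ∀ x, |iteratedDeriv n h x| ≤ B) :
    CbTwo (fun q : ℝ × ℝ => g q.1 * h q.2) := by
  have hg0 := hg.differentiable (by norm_num)
  have hh0 := hh.differentiable (by norm_num)
  have hg1 : Differentiable ℝ (deriv g) := by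
    simpa [iteratedDeriv_one] using hg.differentiable_iteratedDeriv 1 (by norm_num)
  have hh1 : Differentiable ℝ (deriv h) := by
    simpa [iteratedDeriv_one] using hh.differentiable_iteratedDeriv 1 (by norm_num)
  have a0 : ∀ x, |g x| ≤ A := by simpa using hgA 0 (by norm_num)
  have a1 : ∀ x, |deriv g x| ≤ A := by simpa [iteratedDeriv_one] using hgA 1 (by norm_num)
  have a2 : ∀ x, |deriv (deriv g) x| ≤ A := by
    simpa [iteratedDeriv_succ] using hgA 2 (by norm_num)
  have b0 : ∀ x, |h x| ≤ B := by simpa using hhB 0 (by norm_num)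
  have b1 : ∀ x, |deriv h x| ≤ B := by simpa [iteratedDeriv_one] using hhB 1 (by norm_num)
  have b2 : ∀ x, |deriv (deriv h) x| ≤ B := by
    simpa [iteratedDeriv_succ] using hhB 2 (by norm_num)
  have hAB : 0 ≤ A * B := mul_nonneg ((abs_nonneg _).trans (a0 0)) ((abs_nonneg _).trans (b0 0))
  refine ⟨(hg.comp contDiff_fst).mul (hh.comp contDiff_snd), 4 * (A * B), fun p => ⟨?_, ?_⟩⟩
  · exact (norm_fderiv_mul_fst_snd_le hg0 hh0 a0 a1 b0 b1 p).trans (by linarith)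
  · have hfd : fderiv ℝ (fun q : ℝ × ℝ => g q.1 * h q.2) = fun p =>
        (deriv g p.1 * h p.2) • ContinuousLinearMap.fst ℝ ℝ ℝ
          + (g p.1 * deriv h p.2) • ContinuousLinearMap.snd ℝ ℝ ℝ :=
      funext fun p => (hasFDerivAt_mul_fst_snd hg0 hh0 p).fderiv
    have d1 := (hasFDerivAt_mul_fst_snd hg1 hh0 p).differentiableAt
    have d2 := (hasFDerivAt_mul_fst_snd hg0 hh1 p).differentiableAt
    rw [hfd, ((d1.hasFDerivAt.smul_const (ContinuousLinearMap.fst ℝ ℝ ℝ)).fun_add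
      (d2.hasFDerivAt.smul_const (ContinuousLinearMap.snd ℝ ℝ ℝ))).fderiv]
    have n1 := norm_fderiv_mul_fst_snd_le hg1 hh0 a1 a2 b0 b1 p
    have n2 := norm_fderiv_mul_fst_snd_le hg0 hh1 a0 a1 b1 b2 p
    refine le_trans (norm_add_le (E := ℝ × ℝ →L[ℝ] ℝ × ℝ →L[ℝ] ℝ) _ _) ?_
    rw [ContinuousLinearMap.norm_smulRight_apply, ContinuousLinearMap.norm_smulRight_apply]
    have m1 := mul_le_of_le_one_right
      (norm_nonneg (fderiv ℝ (fun q : ℝ × ℝ => deriv g q.1 * h q.2) p))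
      (ContinuousLinearMap.norm_fst_le ℝ ℝ ℝ)
    have m2 := mul_le_of_le_one_right
      (norm_nonneg (fderiv ℝ (fun q : ℝ × ℝ => g q.1 * deriv h q.2) p))
      (ContinuousLinearMap.norm_snd_le ℝ ℝ ℝ)
    linarith

lemma cbTwo_expCutoff {α η : ℝ} (hα : 0 ≤ α) (hη : 0 ≤ η) :
    CbTwo (fun q : ℝ × ℝ => expCutoff α q.1 * expCutoff η q.2) := by
  have key : ∀ {β : ℝ}, 0 ≤ β → ∃ A, ∀ n ≤ 2, ∀ x, |iteratedDeriv n (expCutoff β) x| ≤ A := by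
    intro β hβ
    choose C hC using exists_bound_iteratedDeriv_expCutoff hβ
    refine ⟨max (C 0) (max (C 1) (C 2)), fun n hn x => (hC n x).trans ?_⟩
    interval_cases n <;> simp
  obtain ⟨A, hA⟩ := key hα
  obtain ⟨B, hB⟩ := key hη
  exact cbTwo_mul_fst_snd (contDiff_expCutoff α 2) (contDiff_expCutoff η 2) hA hB

lemma ae_nonneg_of_support {π : Measure (ℝ × ℝ)}
    (hsupp : π {p : ℝ × ℝ | ¬ (0 ≤ p.1 ∧ 0 ≤ p.2)} = 0) : ∀ᵐ p ∂π, 0 ≤ p.1 ∧ 0 ≤ p.2 :=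
  ae_iff.2 hsupp

lemma norm_exp_le_one {α η : ℝ} (hα : 0 ≤ α) (hη : 0 ≤ η) {p : ℝ × ℝ}
    (hp : 0 ≤ p.1 ∧ 0 ≤ p.2) : ‖Real.exp (-(α * p.1) - η * p.2)‖ ≤ 1 := by
  rw [Real.norm_eq_abs, Real.abs_exp, Real.exp_le_one_iff]
  linarith [mul_nonneg hα hp.1, mul_nonneg hη hp.2]

lemma integrable_exp_quadrant {π : Measure (ℝ × ℝ)} [IsFiniteMeasure π]
    (hπ : ∀ᵐ p ∂π, 0 ≤ p.1 ∧ 0 ≤ p.2) {α η : ℝ} (hα : 0 ≤ α) (hη : 0 ≤ η) :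
    Integrable (fun p : ℝ × ℝ => Real.exp (-(α * p.1) - η * p.2)) π := by
  refine (integrable_const (1 : ℝ)).mono' (by fun_prop) ?_
  filter_upwards [hπ] with p hp using norm_exp_le_one hα hη hp

/-- The basic adjoint relationship for the test function `e^{-αz-ηa}`. -/
lemma SatisfiesBAR.laplace_eq {θ σ : ℝ} {π : Measure (ℝ × ℝ)} [IsFiniteMeasure π]
    (hBAR : SatisfiesBAR θ σ π) (hπ : ∀ᵐ p ∂π, 0 ≤ p.1 ∧ 0 ≤ p.2) {α η : ℝ}
    (hα : 0 ≤ α) (hη : 0 ≤ η) :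
    (σ ^ 2 / 2 * α ^ 2 - θ * α - η) * (∫ p, Real.exp (-(α * p.1) - η * p.2) ∂π)
      + η * (∫ p, Real.exp (-(0 * p.1) - η * p.2) ∂π) + θ * α = 0 := by
  have hd (β : ℝ) : Differentiable ℝ (expCutoff β) :=
    (contDiff_expCutoff β 2).differentiable (by norm_num)
  have hd1 (β : ℝ) : Differentiable ℝ (deriv (expCutoff β)) := by
    simpa [iteratedDeriv_one] using
      (contDiff_expCutoff β 2).differentiable_iteratedDeriv 1 (by norm_num)
  have e0 (β : ℝ) {x : ℝ} (hx : 0 ≤ x) : expCutoff β x = Real.exp (-β * x) := by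
    simpa using iteratedDeriv_expCutoff β 0 (by linarith : -1 < x)
  have e1 (β : ℝ) {x : ℝ} (hx : 0 ≤ x) :
      deriv (expCutoff β) x = -β * Real.exp (-β * x) := by
    simpa [iteratedDeriv_one] using iteratedDeriv_expCutoff β 1 (by linarith : -1 < x)
  have e2 (β : ℝ) {x : ℝ} (hx : 0 ≤ x) :
      deriv (deriv (expCutoff β)) x = β ^ 2 * Real.exp (-β * x) := by
    simpa [iteratedDeriv_succ] using iteratedDeriv_expCutoff β 2 (by linarith : -1 < x)
  have hz : (fun q : ℝ × ℝ =>
      fderiv ℝ (fun q : ℝ × ℝ => expCutoff α q.1 * expCutoff η q.2) q (1, 0))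
        = fun q => deriv (expCutoff α) q.1 * expCutoff η q.2 := by
    funext q
    simp [(hasFDerivAt_mul_fst_snd (hd α) (hd η) q).fderiv]
  have h := hBAR _ (cbTwo_expCutoff hα hη)
  simp only [hz] at h
  simp only [(hasFDerivAt_mul_fst_snd (hd1 α) (hd η) _).fderiv,
    (hasFDerivAt_mul_fst_snd (hd α) (hd η) _).fderiv, add_apply, smul_apply,
    ContinuousLinearMap.coe_fst', ContinuousLinearMap.coe_snd',
    smul_eq_mul, mul_one, mul_zero, add_zero, zero_add] at h
  have hae : (fun p : ℝ × ℝ => (σ ^ 2 / 2 * α ^ 2 - θ * α - η)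
        * Real.exp (-(α * p.1) - η * p.2) + η * Real.exp (-(0 * p.1) - η * p.2)) =ᵐ[π]
      fun p => σ ^ 2 / 2 * (deriv (deriv (expCutoff α)) p.1 * expCutoff η p.2)
        + θ * (deriv (expCutoff α) p.1 * expCutoff η p.2)
        + expCutoff α p.1 * deriv (expCutoff η) p.2
        - expCutoff α 0 * deriv (expCutoff η) p.2 := by
    filter_upwards [hπ] with p hp
    have hE : Real.exp (-(α * p.1) - η * p.2) = Real.exp (-α * p.1) * Real.exp (-η * p.2) := by
      rw [← Real.exp_add]; ring_nf
    have hE0 : Real.exp (-(0 * p.1) - η * p.2) = Real.exp (-η * p.2) := by ring_nf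
    rw [hE, hE0]
    rw [e2 α hp.1, e1 α hp.1, e0 α hp.1, e0 η hp.2, e1 η hp.2, e0 α le_rfl]
    simp only [mul_zero, Real.exp_zero]
    ring
  have hint := integral_congr_ae hae
  rw [integral_add ((integrable_exp_quadrant hπ hα hη).const_mul _)
    ((integrable_exp_quadrant hπ le_rfl hη).const_mul _), integral_const_mul,
    integral_const_mul] at hint
  rw [← hint, e1 α le_rfl, e0 η le_rfl] at h
  simp only [mul_zero, Real.exp_zero] at h
  linarith

lemma continuousAt_laplace {π : Measure (ℝ × ℝ)} [IsFiniteMeasure π]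
    (hπ : ∀ᵐ p ∂π, 0 ≤ p.1 ∧ 0 ≤ p.2) {α η : ℝ} (hα : 0 < α) (hη : 0 ≤ η) :
    ContinuousAt (fun β => ∫ p, Real.exp (-(β * p.1) - η * p.2) ∂π) α := by
  refine continuousAt_of_dominated (bound := fun _ => 1) ?_ ?_ (integrable_const _) ?_
  · exact Filter.Eventually.of_forall fun β => by fun_prop
  · filter_upwards [Ioi_mem_nhds hα] with β hβ
    filter_upwards [hπ] with p hp using norm_exp_le_one (le_of_lt hβ) hη hp
  · exact Filter.Eventually.of_forall fun p => by fun_prop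

/-- The Laplace transform formula, including the boundary of the parameter range. -/
lemma SatisfiesBAR.laplace_formula {θ σ : ℝ} (hθ : θ < 0) (hσ : 0 < σ) {π : Measure (ℝ × ℝ)}
    [IsProbabilityMeasure π] (hBAR : SatisfiesBAR θ σ π)
    (hπ : ∀ᵐ p ∂π, 0 ≤ p.1 ∧ 0 ≤ p.2) {α η : ℝ} (hα : 0 ≤ α) (hη : 0 ≤ η) :
    ∫ p, Real.exp (-(α * p.1) - η * p.2) ∂π =
      -2 * θ / (α * σ ^ 2 - θ + Real.sqrt (2 * η * σ ^ 2 + θ ^ 2)) := by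
  set s := Real.sqrt (2 * η * σ ^ 2 + θ ^ 2) with hs
  have hs2 : s ^ 2 = 2 * η * σ ^ 2 + θ ^ 2 := Real.sq_sqrt (by positivity)
  have hs0 : 0 ≤ s := Real.sqrt_nonneg _
  have hσ2 : 0 < σ ^ 2 := by positivity
  have hden : ∀ {β : ℝ}, 0 ≤ β → 0 < β * σ ^ 2 - θ + s := fun hβ => by
    have := mul_nonneg hβ hσ2.le
    linarith
  rcases hη.eq_or_lt with rfl | hη'
  · have hsθ : s = -θ := by nlinarith
    rw [eq_div_iff (hden hα).ne']
    rcases hα.eq_or_lt with rfl | hα'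
    · simp [hsθ]
      ring
    · have h := hBAR.laplace_eq hπ hα le_rfl
      rw [hsθ]
      refine mul_left_cancel₀ hα'.ne' ?_
      linarith
  have hsθ : -θ < s := by
    by_contra! hle
    nlinarith [mul_pos hη' hσ2]
  have hroot : 0 < (s + θ) / σ ^ 2 := div_pos (by linarith) hσ2
  set r := (s + θ) / σ ^ 2 with hr
  have hrσ : r * σ ^ 2 = s + θ := div_mul_cancel₀ _ hσ2.ne'
  have hchar (β : ℝ) : σ ^ 2 / 2 * β ^ 2 - θ * β - η = (β - r) * (β * σ ^ 2 - θ + s) / 2 := by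
    have hη2 : η = r * (s - θ) / 2 := by
      refine mul_right_cancel₀ hσ2.ne' ?_
      linear_combination (-1 / 2) * hs2 - (s - θ) / 2 * hrσ
    rw [hη2]
    linear_combination (β / 2) * hrσ
  have hM : η * (∫ p, Real.exp (-(0 * p.1) - η * p.2) ∂π) = -(θ * r) := by
    have h := hBAR.laplace_eq hπ hroot.le hη
    rw [hchar] at h
    linarith
  have hfactor {β : ℝ} (hβ : 0 ≤ β) : (β - r) *
      ((β * σ ^ 2 - θ + s) * (∫ p, Real.exp (-(β * p.1) - η * p.2) ∂π) + 2 * θ) = 0 := by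
    have h := hBAR.laplace_eq hπ hβ hη
    rw [hM, hchar] at h
    linarith
  have hne {β : ℝ} (hβ : 0 ≤ β) (hβr : β ≠ r) :
      (β * σ ^ 2 - θ + s) * (∫ p, Real.exp (-(β * p.1) - η * p.2) ∂π) + 2 * θ = 0 :=
    (mul_eq_zero.1 (hfactor hβ)).resolve_left (sub_ne_zero.2 hβr)
  have hall : (α * σ ^ 2 - θ + s) * (∫ p, Real.exp (-(α * p.1) - η * p.2) ∂π) + 2 * θ = 0 := by
    by_cases hαr : α = r
    · rw [hαr]
      have hc : ContinuousAt (fun β => (β * σ ^ 2 - θ + s)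
          * (∫ p, Real.exp (-(β * p.1) - η * p.2) ∂π) + 2 * θ) r :=
        (ContinuousAt.mul (by fun_prop) (continuousAt_laplace hπ hroot hη)).add
          continuousAt_const
      refine tendsto_nhds_unique (hc.tendsto.mono_left (nhdsWithin_le_nhds (s := {r}ᶜ))) ?_
      refine tendsto_const_nhds.congr' ?_
      filter_upwards [self_mem_nhdsWithin, mem_nhdsWithin_of_mem_nhds (Ioi_mem_nhds hroot)]
        with β hβr hβ
      exact (hne (le_of_lt hβ) hβr).symm
    · exact hne hα hαr
  rw [eq_div_iff (hden hα).ne']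
  linarith

section LaplaceUniqueness

open scoped NNReal BoundedContinuousFunction

/-- The function `(z, a) ↦ e^{-mz-na}` on the closed quadrant, as a bounded continuous function. -/
noncomputable def quadrantExp (u : ℝ≥0 × ℝ≥0) : ℝ≥0 × ℝ≥0 →ᵇ ℝ :=
  BoundedContinuousFunction.ofNormedAddCommGroup
    (fun p => Real.exp (-(u.1 * p.1 : ℝ) - u.2 * p.2)) (by fun_prop) 1
    (fun p => norm_exp_le_one (p := ((p.1 : ℝ), (p.2 : ℝ))) u.1.2 u.2.2 ⟨p.1.2, p.2.2⟩)

lemma quadrantExp_apply (u p : ℝ≥0 × ℝ≥0) :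
    quadrantExp u p = Real.exp (-(u.1 * p.1 : ℝ) - u.2 * p.2) := rfl

/-- The functions `quadrantExp u` form a multiplicative submonoid. -/
noncomputable def quadrantExpSubmonoid : Submonoid (ℝ≥0 × ℝ≥0 →ᵇ ℝ) where
  carrier := range quadrantExp
  one_mem' := ⟨0, by ext p; simp [quadrantExp_apply]⟩
  mul_mem' := by
    rintro _ _ ⟨u, rfl⟩ ⟨v, rfl⟩
    refine ⟨u + v, ?_⟩
    ext p
    simp only [quadrantExp_apply, BoundedContinuousFunction.mul_apply, ← Real.exp_add]
    congr 1
    simp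
    ring

/-- The star subalgebra spanned by the functions `quadrantExp u`. -/
noncomputable def quadrantExpAlgebra : StarSubalgebra ℝ (ℝ≥0 × ℝ≥0 →ᵇ ℝ) where
  toSubalgebra := Algebra.adjoin ℝ quadrantExpSubmonoid
  star_mem' := by
    intro f hf
    have : star f = f := by ext p; simp
    rwa [this]

/-- Finite measures on the closed quadrant are determined by their Laplace transforms. -/
lemma ext_of_integral_quadrantExp_eq {μ ν : Measure (ℝ≥0 × ℝ≥0)} [IsFiniteMeasure μ]
    [IsFiniteMeasure ν] (h : ∀ u, ∫ p, quadrantExp u p ∂μ = ∫ p, quadrantExp u p ∂ν) :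
    μ = ν := by
  refine ext_of_forall_mem_subalgebra_integral_eq_of_polish (𝕜 := ℝ) (A := quadrantExpAlgebra)
    ?_ fun g hg => ?_
  · have hmem (u : ℝ≥0 × ℝ≥0) : quadrantExp u ∈ quadrantExpAlgebra :=
      Algebra.subset_adjoin ⟨u, rfl⟩
    intro p q hpq
    by_contra! hsep
    have hval (u : ℝ≥0 × ℝ≥0) : quadrantExp u p = quadrantExp u q :=
      hsep _ ⟨_, ⟨quadrantExp u, hmem u, rfl⟩, rfl⟩
    have h1 := hval (1, 0)
    have h2 := hval (0, 1)
    simp only [quadrantExp_apply, Real.exp_eq_exp] at h1 h2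
    exact hpq (Prod.ext (by simpa using h1) (by simpa using h2))
  · replace hg : g ∈ Submodule.span ℝ (Submonoid.closure
        (quadrantExpSubmonoid : Set (ℝ≥0 × ℝ≥0 →ᵇ ℝ)) : Set (ℝ≥0 × ℝ≥0 →ᵇ ℝ)) := by
      rw [← Algebra.adjoin_eq_span]
      exact hg
    rw [Submonoid.closure_eq] at hg
    induction hg using Submodule.span_induction with
    | mem f hf => obtain ⟨u, rfl⟩ := hf; exact h u
    | zero => simp
    | add f g _ _ hf hg =>
      simp only [BoundedContinuousFunction.add_apply]
      rw [integral_add (f.integrable _) (g.integrable _),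
        integral_add (f.integrable _) (g.integrable _), hf, hg]
    | smul c f _ hf =>
      simp only [BoundedContinuousFunction.smul_apply, integral_smul]
      rw [hf]

lemma measure_ext_of_laplace_eq {μ ν : Measure (ℝ × ℝ)} [IsFiniteMeasure μ] [IsFiniteMeasure ν]
    (hμ : ∀ᵐ p ∂μ, 0 ≤ p.1 ∧ 0 ≤ p.2) (hν : ∀ᵐ p ∂ν, 0 ≤ p.1 ∧ 0 ≤ p.2)
    (h : ∀ α ≥ (0 : ℝ), ∀ η ≥ (0 : ℝ), ∫ p, Real.exp (-(α * p.1) - η * p.2) ∂μ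
      = ∫ p, Real.exp (-(α * p.1) - η * p.2) ∂ν) : μ = ν := by
  let t : ℝ × ℝ → ℝ≥0 × ℝ≥0 := fun p => (p.1.toNNReal, p.2.toNNReal)
  let c : ℝ≥0 × ℝ≥0 → ℝ × ℝ := fun p => (p.1, p.2)
  have ht : Measurable t := by fun_prop
  have hc : Measurable c := by fun_prop
  have hmap {ρ : Measure (ℝ × ℝ)} (hρ : ∀ᵐ p ∂ρ, 0 ≤ p.1 ∧ 0 ≤ p.2) :
      (ρ.map t).map c = ρ := by
    rw [Measure.map_map hc ht]
    refine (Measure.map_congr ?_).trans Measure.map_id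
    filter_upwards [hρ] with p hp
    simp [t, c, hp.1, hp.2]
  have hint {ρ : Measure (ℝ × ℝ)} (hρ : ∀ᵐ p ∂ρ, 0 ≤ p.1 ∧ 0 ≤ p.2) (u : ℝ≥0 × ℝ≥0) :
      ∫ p, quadrantExp u p ∂(ρ.map t) = ∫ p, Real.exp (-(u.1 * p.1) - u.2 * p.2) ∂ρ := by
    rw [integral_map ht.aemeasurable (quadrantExp u).continuous.aestronglyMeasurable]
    refine integral_congr_ae ?_
    filter_upwards [hρ] with p hp
    simp [quadrantExp_apply, t, hp.1, hp.2]
  rw [← hmap hμ, ← hmap hν]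
  congr 1
  refine ext_of_integral_quadrantExp_eq fun u => ?_
  rw [hint hμ, hint hν]
  exact h _ u.1.2 _ u.2.2

end LaplaceUniqueness

/-- (Equation (1dlap): the one-dimensional basic adjoint relationship determines the joint
Laplace transform.)  Fix `θ < 0`, `σ > 0`.  If the Borel probability measure `π` on `[0,∞)²`
satisfies the basic adjoint relationship, then for all `α, η > 0`,
`∫∫ e^{−αz−ηa} dπ(z,a) = −2θ / (ασ² − θ + √(2ησ² + θ²))`;
in particular, at most one Borel probability measure on `[0,∞)²` satisfies the relationship. -/
theorem bar_determines_laplace_transform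
    (θ σ : ℝ) (hθ : θ < 0) (hσ : 0 < σ)
    (π : Measure (ℝ × ℝ)) [IsProbabilityMeasure π]
    (hsupp : π {p : ℝ × ℝ | ¬ (0 ≤ p.1 ∧ 0 ≤ p.2)} = 0)
    (hBAR : SatisfiesBAR θ σ π) :
    (∀ α > (0 : ℝ), ∀ η > (0 : ℝ),
      ∫ p, Real.exp (-(α * p.1) - η * p.2) ∂π =
        -2 * θ / (α * σ ^ 2 - θ + Real.sqrt (2 * η * σ ^ 2 + θ ^ 2))) ∧
    (∀ π' : Measure (ℝ × ℝ), IsProbabilityMeasure π' →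
      π' {p : ℝ × ℝ | ¬ (0 ≤ p.1 ∧ 0 ≤ p.2)} = 0 →
      SatisfiesBAR θ σ π' → π' = π) := by
  have hπ := ae_nonneg_of_support hsupp
  refine ⟨fun α hα η hη => hBAR.laplace_formula hθ hσ hπ hα.le hη.le, fun π' _ hsupp' hBAR' => ?_⟩
  have hπ' := ae_nonneg_of_support hsupp'
  refine measure_ext_of_laplace_eq hπ' hπ fun α hα η hη => ?_
  rw [hBAR'.laplace_formula hθ hσ hπ' hα hη, hBAR.laplace_formula hθ hσ hπ hα hη]
end

section
/- (Appendix A.) Let L : [0,∞) × (0,∞) → ℝ be continuous and satisfy, for all α > 0 and η > 0, ((1/2)σ²α² − αθ − η) L(α,η) + η L(0,η) + αθ = 0. Then for all α ≥ 0 and η > 0, L(α,η) = −2θ / (ασ² − θ + √(2ησ² + θ²)). -/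
/-- (Appendix A.) Fix `θ < 0` and `σ > 0`.  Let `L : [0,∞) × (0,∞) → ℝ` be continuous and
satisfy, for all `α > 0`, `η > 0`,
`((1/2)σ²α² − αθ − η) L(α,η) + η L(0,η) + αθ = 0`.
Then for all `α ≥ 0` and `η > 0`,
`L(α,η) = −2θ / (ασ² − θ + √(2ησ² + θ²))`. -/
theorem laplace_transform_from_functional_equation
    (θ σ : ℝ) (hθ : θ < 0) (hσ : 0 < σ)
    (L : ℝ → ℝ → ℝ)
    (hLcont : ContinuousOn (fun p : ℝ × ℝ => L p.1 p.2) (Set.Ici 0 ×ˢ Set.Ioi 0))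
    (hL : ∀ α > (0 : ℝ), ∀ η > (0 : ℝ),
      ((1 / 2) * σ ^ 2 * α ^ 2 - α * θ - η) * L α η + η * L 0 η + α * θ = 0) :
    ∀ α ≥ (0 : ℝ), ∀ η > (0 : ℝ),
      L α η = -2 * θ / (α * σ ^ 2 - θ + Real.sqrt (2 * η * σ ^ 2 + θ ^ 2)) := by
  intro α hα η hη
  have hrad : 0 ≤ 2 * η * σ ^ 2 + θ ^ 2 := by positivity
  set S := Real.sqrt (2 * η * σ ^ 2 + θ ^ 2)
  have hS2 : S ^ 2 = 2 * η * σ ^ 2 + θ ^ 2 := Real.sq_sqrt hrad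
  have hS0 : 0 ≤ S := Real.sqrt_nonneg _
  have hσ2 : 0 < σ ^ 2 := by positivity
  have hsum : 0 < θ + S := by nlinarith [mul_pos hη hσ2]
  have hden : ∀ x ≥ (0 : ℝ), 0 < x * σ ^ 2 - θ + S := fun x hx => by
    nlinarith [mul_nonneg hx hσ2.le]
  -- `r` is the positive root of the quadratic coefficient.
  obtain ⟨r, hr⟩ : ∃ r : ℝ, r * σ ^ 2 = θ + S := ⟨(θ + S) / σ ^ 2, by field_simp⟩
  have hr0 : 0 < r := pos_of_mul_pos_left (hr ▸ hsum) hσ2.le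
  have hη_eq : η = r * (S - θ) / 2 := by
    apply mul_right_cancel₀ hσ2.ne'
    linear_combination (-1 / 2) * hS2 - (S - θ) / 2 * hr
  have hquad : ∀ x : ℝ, (1 / 2) * σ ^ 2 * x ^ 2 - x * θ - η =
      (x - r) * (x * σ ^ 2 - θ + S) / 2 := fun x => by
    rw [hη_eq]
    linear_combination x / 2 * hr
  have hzero : η * L 0 η = -(r * θ) := by
    have h := hL r hr0 η hη
    rw [hquad r] at h
    linear_combination h
  have hne : ∀ x > (0 : ℝ), x ≠ r → L x η = -2 * θ / (x * σ ^ 2 - θ + S) := by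
    intro x hx hxr
    rw [eq_div_iff (hden x hx.le).ne']
    have h := hL x hx η hη
    rw [hquad x, hzero] at h
    apply mul_left_cancel₀ (sub_ne_zero.mpr hxr)
    linear_combination 2 * h
  rcases hα.eq_or_lt with rfl | hα
  · rw [eq_div_iff (hden 0 le_rfl).ne']
    apply mul_left_cancel₀ hr0.ne'
    linear_combination 2 * hzero - 2 * L 0 η * hη_eq
  by_cases hαr : α = r
  · subst hαr
    have hmem : Set.Ici (0 : ℝ) ×ˢ Set.Ioi (0 : ℝ) ∈ nhds (α, η) :=
      prod_mem_nhds (Ici_mem_nhds hα) (Ioi_mem_nhds hη)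
    have hcont : ContinuousAt (fun x => L x η) α :=
      (hLcont.continuousAt hmem).comp (f := fun x : ℝ => (x, η)) (by fun_prop)
    have hcont' : ContinuousAt (fun x => -2 * θ / (x * σ ^ 2 - θ + S)) α :=
      ContinuousAt.div (by fun_prop) (by fun_prop) (hden α hα.le).ne'
    have heq : (fun x => L x η) =ᶠ[nhdsWithin α {α}ᶜ]
        fun x => -2 * θ / (x * σ ^ 2 - θ + S) := by
      filter_upwards [self_mem_nhdsWithin, mem_nhdsWithin_of_mem_nhds (Ioi_mem_nhds hα)]
        with x hx hx0 using hne x hx0 hx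
    exact tendsto_nhds_unique (hcont.tendsto.mono_left nhdsWithin_le_nhds)
      ((hcont'.tendsto.mono_left nhdsWithin_le_nhds).congr' heq.symm)
  · exact hne α hα hαr
end

section
/- (Equations (1dAtpre)–(1dAt): explicit left derivative of the one-dimensional Skorohod map in the drift direction.) For every continuous x : [0,∞) → ℝ and every t ≥ 0, the limit lim_{ε→0+} (z(t) − z_ε(t))/ε exists and equals t − sup{s ∈ [0,t] : z(s) = 0}, with the convention sup ∅ = 0. -/
open Set Filter

/-- The regulator `sup_{0 ≤ s ≤ t} (-x_ε(s)) ∨ 0` in the Skorohod reflection of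
`x_ε(s) = x(s) - ε s`. -/
noncomputable def driftRegulator (x : ℝ → ℝ) (ε t : ℝ) : ℝ :=
  max (sSup ((fun s => -(x s - ε * s)) '' Icc 0 t)) 0

section driftRegulator

variable {x : ℝ → ℝ} {ε t : ℝ}

lemma driftRegulator_nonneg : 0 ≤ driftRegulator x ε t := le_max_right _ _

lemma le_driftRegulator (hx : ContinuousOn x (Ici 0)) {s : ℝ} (hs : s ∈ Icc 0 t) :
    ε * s - x s ≤ driftRegulator x ε t := by
  have hc : ContinuousOn (fun s => -(x s - ε * s)) (Icc 0 t) := by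
    have := hx.mono (Icc_subset_Ici_self : Icc 0 t ⊆ Ici 0)
    fun_prop
  have h := le_csSup (isCompact_Icc.image_of_continuousOn hc).bddAbove (mem_image_of_mem _ hs)
  exact le_max_of_le_left (by linarith)

lemma driftRegulator_le {B : ℝ} (h0 : 0 ≤ B) (h : ∀ s ∈ Icc 0 t, ε * s - x s ≤ B) :
    driftRegulator x ε t ≤ B := by
  refine max_le (Real.sSup_le ?_ h0) h0
  rintro _ ⟨s, hs, rfl⟩
  linarith [h s hs]

/-- The regulator of the undrifted path is monotone in time. -/
lemma driftRegulator_zero_mono (hx : ContinuousOn x (Ici 0)) {s : ℝ} (hst : s ≤ t) :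
    driftRegulator x 0 s ≤ driftRegulator x 0 t :=
  driftRegulator_le driftRegulator_nonneg fun _ hr =>
    le_driftRegulator hx ⟨hr.1, hr.2.trans hst⟩

/-- A path that attains its running regulator at time `s` is reflected to zero there. -/
lemma add_driftRegulator_eq_zero (hx : ContinuousOn x (Ici 0)) {s : ℝ} (hs : s ∈ Icc 0 t)
    (h : -x s = driftRegulator x 0 t) : x s + driftRegulator x 0 s = 0 := by
  have h1 := driftRegulator_zero_mono hx hs.2
  have h2 := le_driftRegulator (ε := 0) hx (right_mem_Icc.2 hs.1)
  linarith

/-- The last zero of the reflected path gives the lower bound for the drifted regulator. -/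
lemma driftRegulator_zero_add_mul_sSup_le (hx : ContinuousOn x (Ici 0)) :
    driftRegulator x 0 t + ε * sSup {s | s ∈ Icc 0 t ∧ x s + driftRegulator x 0 s = 0}
      ≤ driftRegulator x ε t := by
  set M := driftRegulator x 0 t
  set S := {s | s ∈ Icc 0 t ∧ x s + driftRegulator x 0 s = 0}
  have hcont := hx.mono (Icc_subset_Ici_self : Icc 0 t ⊆ Ici 0)
  rcases S.eq_empty_or_nonempty with hS | ⟨s₀, hs₀, hz₀⟩
  · -- without zeros, the supremum of `-x` is not reached, so the regulator vanishes
    have hM : M ≤ 0 := by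
      by_contra! hM
      rcases (Icc (0 : ℝ) t).eq_empty_or_nonempty with he | hne
      · exact hM.not_ge (driftRegulator_le le_rfl (by simp [he]))
      obtain ⟨a, ha, hmin⟩ := isCompact_Icc.exists_isMinOn hne hcont
      have hM' : M ≤ max (-x a) 0 := driftRegulator_le (le_max_right _ _) fun s hs =>
        le_max_of_le_left (by linarith [isMinOn_iff.1 hmin s hs])
      have hle := le_driftRegulator (ε := 0) hx ha
      have hMa : M ≤ -x a := (le_max_iff.1 hM').resolve_right hM.not_ge
      have : a ∈ S := ⟨ha, add_driftRegulator_eq_zero hx ha (by linarith)⟩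
      simp [hS] at this
    rw [hS, Real.sSup_empty]
    linarith [driftRegulator_nonneg (x := x) (ε := ε) (t := t)]
  · obtain ⟨a, ha, hmin⟩ := isCompact_Icc.exists_isMinOn ⟨s₀, hs₀⟩ hcont
    have hMa : M ≤ -x a := by
      refine driftRegulator_le ?_ fun s hs => by linarith [isMinOn_iff.1 hmin s hs]
      linarith [isMinOn_iff.1 hmin s₀ hs₀, driftRegulator_nonneg (x := x) (ε := 0) (t := s₀)]
    have haM : -x a = M :=
      le_antisymm (by linarith [le_driftRegulator (ε := 0) hx ha]) hMa
    have hA : IsCompact (Icc 0 t ∩ x ⁻¹' {-M}) :=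
      isCompact_Icc.of_isClosed_subset
        (hcont.preimage_isClosed_of_isClosed isClosed_Icc isClosed_singleton) inter_subset_left
    obtain ⟨b, ⟨hb, hxb⟩, hbmax⟩ := hA.exists_isGreatest ⟨a, ha, by simp [← haM]⟩
    replace hxb : x b = -M := hxb
    have hbS : IsGreatest S b := by
      refine ⟨⟨hb, add_driftRegulator_eq_zero hx hb (by linarith)⟩, fun s ⟨hs, hz⟩ => ?_⟩
      by_contra! hbs
      have h1 := le_driftRegulator (ε := 0) hx (⟨hb.1, hbs.le⟩ : b ∈ Icc 0 s)
      have h2 := le_driftRegulator (ε := 0) hx hs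
      refine hbs.not_ge (hbmax ⟨hs, ?_⟩)
      change x s = -M
      linarith
    rw [hbS.csSup_eq]
    linarith [le_driftRegulator (ε := ε) hx hb]

/-- If `-x` stays strictly below its regulator on `(τ, t]`, then the drifted regulator grows
asymptotically at rate at most `τ` in the drift. -/
lemma eventually_driftRegulator_le (hx : ContinuousOn x (Ici 0)) {τ δ : ℝ} (hτ : 0 ≤ τ)
    (hδ : 0 < δ) (hlt : ∀ s ∈ Ioc τ t, -x s < driftRegulator x 0 t) :
    ∀ᶠ ε in nhdsWithin 0 (Ioi 0),
      driftRegulator x ε t ≤ driftRegulator x 0 t + ε * (τ + δ) := by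
  set M := driftRegulator x 0 t
  have hM : 0 ≤ M := driftRegulator_nonneg
  obtain ⟨c, hc, hcM⟩ : ∃ c > 0, ∀ s ∈ Icc (τ + δ) t, -x s ≤ M - c := by
    rcases (Icc (τ + δ) t).eq_empty_or_nonempty with he | hne
    · exact ⟨1, one_pos, by simp [he]⟩
    have hcont : ContinuousOn x (Icc (τ + δ) t) :=
      hx.mono fun s hs => mem_Ici.2 (by linarith [hs.1])
    obtain ⟨a, ha, hmin⟩ := isCompact_Icc.exists_isMinOn hne hcont
    refine ⟨M + x a, by linarith [hlt a ⟨by linarith [ha.1], ha.2⟩], fun s hs => ?_⟩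
    linarith [isMinOn_iff.1 hmin s hs]
  have hsmall : ∀ᶠ ε : ℝ in nhdsWithin 0 (Ioi 0), ε * t < c := by
    have : Tendsto (fun ε : ℝ => ε * t) (nhds 0) (nhds 0) := by
      simpa using (continuous_mul_const t).tendsto 0
    exact (this.mono_left nhdsWithin_le_nhds).eventually_lt_const hc
  filter_upwards [hsmall, self_mem_nhdsWithin] with ε hεt hε
  replace hε : 0 < ε := hε
  have hεδ : 0 ≤ ε * (τ + δ) := by positivity
  refine driftRegulator_le (by linarith) fun s hs => ?_
  rcases le_total s (τ + δ) with h | h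
  · linarith [le_driftRegulator (ε := 0) hx hs, mul_le_mul_of_nonneg_left h hε.le]
  · linarith [hcM s ⟨h, hs.2⟩, mul_le_mul_of_nonneg_left hs.2 hε.le]

/-- The right derivative at zero drift of the regulator is the last zero of the reflected path. -/
lemma tendsto_driftRegulator_slope (hx : ContinuousOn x (Ici 0)) :
    Tendsto (fun ε => (driftRegulator x ε t - driftRegulator x 0 t) / ε)
      (nhdsWithin 0 (Ioi 0))
      (nhds (sSup {s | s ∈ Icc 0 t ∧ x s + driftRegulator x 0 s = 0})) := by
  set S := {s | s ∈ Icc 0 t ∧ x s + driftRegulator x 0 s = 0}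
  have hτ : 0 ≤ sSup S := Real.sSup_nonneg fun s hs => hs.1.1
  have hlt : ∀ s ∈ Ioc (sSup S) t, -x s < driftRegulator x 0 t := by
    intro s hs
    have hs' : s ∈ Icc 0 t := ⟨hτ.trans hs.1.le, hs.2⟩
    have hle := le_driftRegulator (ε := 0) hx hs'
    refine lt_of_le_of_ne (by linarith) fun heq => hs.1.not_ge ?_
    exact le_csSup ⟨t, fun r hr => hr.1.2⟩ ⟨hs', add_driftRegulator_eq_zero hx hs' heq⟩
  refine tendsto_order.2 ⟨fun a ha => ?_, fun b hb => ?_⟩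
  · filter_upwards [self_mem_nhdsWithin] with ε hε
    replace hε : 0 < ε := hε
    refine ha.trans_le ((le_div_iff₀ hε).2 ?_)
    linarith [driftRegulator_zero_add_mul_sSup_le (ε := ε) (t := t) hx]
  · filter_upwards [eventually_driftRegulator_le hx hτ (half_pos (sub_pos.2 hb)) hlt,
      self_mem_nhdsWithin] with ε h hε
    replace hε : 0 < ε := hε
    have : sSup S + (b - sSup S) / 2 < b := by linarith
    refine ((div_le_iff₀ hε).2 ?_).trans_lt this
    linarith

end driftRegulator

/-- (Equations (1dAtpre)–(1dAt).)  For a continuous `x : [0,∞) → ℝ` and `ε ≥ 0`, set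
`x_ε(t) = x(t) − εt`, `y_ε(t) = max(sup_{0≤s≤t}(−x_ε(s)), 0)` and `z_ε(t) = x_ε(t) + y_ε(t)`
(the one-dimensional Skorohod reflection of `x_ε`), and write `z = z_0`.  Then for every `t ≥ 0`
the limit `lim_{ε→0+} (z(t) − z_ε(t))/ε` exists and equals
`t − sup{s ∈ [0,t] : z(s) = 0}`, with the convention `sup ∅ = 0`. -/
theorem one_dim_drift_derivative
    (x : ℝ → ℝ) (hx : ContinuousOn x (Set.Ici 0))
    (zE : ℝ → ℝ → ℝ)
    (hzE : ∀ ε ≥ (0 : ℝ), ∀ t ≥ (0 : ℝ),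
      zE ε t = (x t - ε * t) +
        max (sSup ((fun s => -(x s - ε * s)) '' Set.Icc 0 t)) 0) :
    ∀ t ≥ (0 : ℝ),
      Filter.Tendsto (fun ε => (zE 0 t - zE ε t) / ε) (nhdsWithin 0 (Set.Ioi 0))
        (nhds (t - sSup {s | s ∈ Set.Icc 0 t ∧ zE 0 s = 0})) := by
  intro t ht
  have hz : ∀ ε ≥ (0 : ℝ), ∀ s ≥ (0 : ℝ), zE ε s = x s - ε * s + driftRegulator x ε s := hzE
  have hS : {s | s ∈ Set.Icc 0 t ∧ zE 0 s = 0}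
      = {s | s ∈ Set.Icc 0 t ∧ x s + driftRegulator x 0 s = 0} := by
    ext s
    refine and_congr_right fun hs => ?_
    rw [hz 0 le_rfl s hs.1, zero_mul, sub_zero]
  rw [hS]
  refine ((tendsto_driftRegulator_slope hx).const_sub t).congr' ?_
  filter_upwards [self_mem_nhdsWithin] with ε hε
  replace hε : 0 < ε := hε
  rw [hz 0 le_rfl t ht, hz ε hε.le t ht]
  field_simp
  ring
end

section
/- (One-dimensional case of Corollary 5.8: the continuous part of A is t.) Suppose the zero set {s ∈ [0,∞) : z(s) = 0} has Lebesgue measure zero. Then B is a pure jump function: for every t ≥ 0, B(t) = Σ_{0<s≤t} (B(s) − B(s⁻)), where B(s⁻) denotes the left limit of B at s and the sum has at most countably many nonzero terms. Equivalently, A(t) − Σ_{0<s≤t} (A(s) − A(s⁻)) = t for all t ≥ 0. -/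
open Set Filter MeasureTheory

/-- A monotone real function differs from its left limits at countably many points only. -/
theorem Monotone.countable_ne_leftLim {f : ℝ → ℝ} (hf : Monotone f) :
    {s | f s ≠ Function.leftLim f s}.Countable := by
  refine hf.countable_not_continuousAt.mono ?_
  intro s hs
  contrapose! hs
  have hc : ContinuousAt f s := by simpa using hs
  simpa using hc.continuousWithinAt.leftLim_eq.symm

/-- The jumps of a monotone real function on `(0, t]` sum to its increment, as soon as the jump
intervals cover almost every point of `(f 0, f t)`. -/
theorem Monotone.tsum_jumps_eq_sub_of_ae_covered {f : ℝ → ℝ} (hf : Monotone f) {t : ℝ}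
    (ht : 0 ≤ t) {Z : Set ℝ} (hZ : volume Z = 0)
    (hcov : ∀ x ∈ Ioo (f 0) (f t), x ∉ Z →
      ∃ s ∈ Ioc 0 t, x ∈ Ico (Function.leftLim f s) (f s)) :
    ∑' s : Ioc (0 : ℝ) t, (f s - Function.leftLim f s) = f t - f 0 := by
  set J : Set ℝ := {s | s ∈ Ioc 0 t ∧ f s ≠ Function.leftLim f s} with hJ
  have : Countable J := (hf.countable_ne_leftLim.mono fun s hs => hs.2).to_subtype
  let I : J → Set ℝ := fun s => Ico (Function.leftLim f s) (f s)
  have hdisj : Pairwise (Function.onFun Disjoint I) := by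
    have key : ∀ s s' : J, s < s' → Disjoint (I s) (I s') := by
      intro s s' h
      rw [Set.disjoint_left]
      intro x hx hx'
      exact absurd (hx.2.trans_le (hf.le_leftLim h)) (not_lt.2 hx'.1)
    intro s s' h
    rcases lt_or_gt_of_ne h with h | h
    · exact key s s' h
    · exact (key s' s h).symm
  have hvol : volume (⋃ s, I s) = ENNReal.ofReal (f t - f 0) := by
    apply le_antisymm
    · rw [← Real.volume_Ico]
      refine measure_mono (iUnion_subset fun s => Ico_subset_Ico ?_ ?_)
      · exact hf.le_leftLim s.2.1.1
      · exact hf s.2.1.2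
    · rw [← Real.volume_Ioo, ← measure_sdiff_null hZ]
      refine measure_mono fun x hx => ?_
      obtain ⟨s, hs, hxs⟩ := hcov x hx.1 hx.2
      exact mem_iUnion.2 ⟨⟨s, hs, (hxs.1.trans_lt hxs.2).ne'⟩, hxs⟩
  rw [MeasureTheory.measure_iUnion hdisj fun s => measurableSet_Ico] at hvol
  have hnn : ∀ s, 0 ≤ f s - Function.leftLim f s := fun s => sub_nonneg.2 (hf.leftLim_le le_rfl)
  have hsum : ∑' s : J, (f s - Function.leftLim f s) = f t - f 0 := by
    have h := congrArg ENNReal.toReal hvol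
    rw [ENNReal.tsum_toReal_eq (fun s => by simp [I]),
      ENNReal.toReal_ofReal (sub_nonneg.2 (hf ht))] at h
    rw [← h]
    refine tsum_congr fun s => ?_
    rw [Real.volume_Ico, ENNReal.toReal_ofReal (hnn s)]
  rw [← hsum, tsum_subtype (Ioc 0 t) fun s => f s - Function.leftLim f s,
    tsum_subtype J fun s => f s - Function.leftLim f s]
  refine tsum_congr fun s => ?_
  by_cases h : f s = Function.leftLim f s <;> simp [indicator, hJ, h]

/-- (One-dimensional case of Corollary 5.8: the continuous part of `A` is `t`.)  For a continuous
`z : [0,∞) → [0,∞)` whose zero set has Lebesgue measure zero, with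
`B(t) = sup{s ∈ [0,t] : z(s) = 0}` (convention `sup ∅ = 0`) and `A(t) = t − B(t)`,
the function `B` is a pure jump function: for every `t ≥ 0`,
`B(t) = Σ_{0<s≤t} (B(s) − B(s⁻))`, where `B(s⁻)` is the left limit of `B` at `s`, and
the sum has at most countably many nonzero terms. -/
theorem last_zero_process_pure_jump
    (z : ℝ → ℝ) (hzc : ContinuousOn z (Set.Ici 0)) (hznn : ∀ t ≥ (0 : ℝ), 0 ≤ z t)
    (hzero : volume {s : ℝ | 0 ≤ s ∧ z s = 0} = 0)
    (B A : ℝ → ℝ) (hB : ∀ t, B t = sSup {s | s ∈ Set.Icc 0 t ∧ z s = 0})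
    (hA : ∀ t, A t = t - B t) :
    ∀ t ≥ (0 : ℝ),
      {s | s ∈ Set.Ioc 0 t ∧ B s ≠ Function.leftLim B s}.Countable ∧
      B t = ∑' s : (Set.Ioc (0 : ℝ) t), (B s - Function.leftLim B s) ∧
      A t - ∑' s : (Set.Ioc (0 : ℝ) t), (A s - Function.leftLim A s) = t := by
  have hbdd : ∀ t, BddAbove {s | s ∈ Icc 0 t ∧ z s = 0} := fun t => ⟨t, fun s hs => hs.1.2⟩
  have hle : ∀ {s t}, 0 ≤ s → s ≤ t → z s = 0 → s ≤ B t := fun h0 hst hz => by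
    rw [hB]
    exact le_csSup (hbdd _) ⟨⟨h0, hst⟩, hz⟩
  have hB_le : ∀ {t c}, 0 ≤ c → (∀ s, 0 ≤ s → s ≤ t → z s = 0 → s ≤ c) → B t ≤ c :=
    fun hc h => by
      rw [hB]
      exact Real.sSup_le (fun s hs => h s hs.1.1 hs.1.2 hs.2) hc
  have hBnn : ∀ t, 0 ≤ B t := fun t => by
    rw [hB]
    exact Real.sSup_nonneg fun s hs => hs.1.1
  have hmono : Monotone B := fun a b hab =>
    hB_le (hBnn b) fun s h0 hs hz => hle h0 (hs.trans hab) hz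
  have hB0 : B 0 = 0 := le_antisymm (hB_le le_rfl fun s _ hs _ => hs) (hBnn 0)
  intro t ht
  have hsum : ∑' s : Ioc (0 : ℝ) t, (B s - Function.leftLim B s) = B t := by
    rw [hmono.tsum_jumps_eq_sub_of_ae_covered ht hzero, hB0, sub_zero]
    rintro x ⟨hx0, hxt⟩ hxZ
    rw [hB0] at hx0
    obtain ⟨u, hu0, hut, hzu, hxu⟩ : ∃ u, 0 ≤ u ∧ u ≤ t ∧ z u = 0 ∧ x < u := by
      by_contra! h
      exact absurd (hB_le hx0.le h) (not_le.2 hxt)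
    have hcl : IsClosed (Ici x ∩ z ⁻¹' {0}) :=
      (hzc.mono (Ici_subset_Ici.2 hx0.le)).preimage_isClosed_of_isClosed isClosed_Ici
        isClosed_singleton
    have hbelow : BddBelow (Ici x ∩ z ⁻¹' {0}) := ⟨x, fun s hs => hs.1⟩
    have hs := hcl.csInf_mem ⟨u, hxu.le, hzu⟩ hbelow
    set s := sInf (Ici x ∩ z ⁻¹' {0})
    have hxs : x ≤ s := hs.1
    have hzs : z s = 0 := hs.2
    have hne : x ≠ s := fun h => hxZ ⟨hx0.le, h ▸ hzs⟩
    have hs0 : 0 < s := hx0.trans_le hxs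
    refine ⟨s, ⟨hs0, (csInf_le hbelow ⟨hxu.le, hzu⟩).trans hut⟩, ?_,
      (lt_of_le_of_ne hxs hne).trans_le (hle hs0.le le_rfl hzs)⟩
    refine le_of_tendsto (hmono.tendsto_leftLim s) ?_
    filter_upwards [self_mem_nhdsWithin] with v hv
    refine hB_le hx0.le fun w _ hwv hzw => ?_
    by_contra! hxw
    exact absurd (csInf_le hbelow ⟨hxw.le, hzw⟩) (not_le.2 (hwv.trans_lt hv))
  have hAjump : ∀ s, A s - Function.leftLim A s = -(B s - Function.leftLim B s) := fun s => by
    have hlim : Tendsto A (nhdsWithin s (Iio s)) (nhds (s - Function.leftLim B s)) := by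
      rw [funext hA]
      exact (tendsto_id.mono_left nhdsWithin_le_nhds).sub (hmono.tendsto_leftLim s)
    rw [leftLim_eq_of_tendsto hlim, hA]
    ring
  refine ⟨hmono.countable_ne_leftLim.mono fun s hs => hs.2, hsum.symm, ?_⟩
  simp only [hAjump]
  rw [tsum_neg, hsum, hA]
  ring
end

section
/- (Lemma 5.3: fixed-point characterization of the derivative b.) Under the stated hypotheses, for all i, j and t ≥ 0, b_i^j(t) = sup{ δ_i^j s + Σ_k P_i^k b_k^j(s) : s ∈ [0,t], z_i(s) = 0 }, with the convention sup ∅ = 0, where δ_i^j is the Kronecker delta and P_i^k denotes entry (i,k) of P. -/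
open Set Filter

/-- Powers of an element of a complex Banach algebra whose spectrum lies in the open unit disc
tend to zero. -/
theorem tendsto_pow_zero_of_spectrum_norm_lt_one {A : Type*} [NormedRing A] [NormedAlgebra ℂ A]
    [CompleteSpace A] [Nontrivial A] (a : A) (ha : ∀ μ ∈ spectrum ℂ a, ‖μ‖ < 1) :
    Tendsto (fun n : ℕ => a ^ n) atTop (nhds 0) := by
  have hρ : spectralRadius ℂ a < ((1 : NNReal) : ENNReal) :=
    spectrum.spectralRadius_lt_of_forall_lt a fun k hk => ha k hk
  obtain ⟨r, hr, hr1⟩ := ENNReal.lt_iff_exists_nnreal_btwn.1 hρ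
  have hr1' : r < 1 := by exact_mod_cast hr1
  have hev : ∀ᶠ n : ℕ in atTop, ‖a ^ n‖ ≤ (r : ℝ) ^ n := by
    have hgelfand := spectrum.pow_nnnorm_pow_one_div_tendsto_nhds_spectralRadius a
    filter_upwards [hgelfand.eventually_lt_const hr, eventually_gt_atTop 0] with n hn hn0
    have hn0' : (0 : ℝ) < n := by exact_mod_cast hn0
    rw [one_div, ENNReal.rpow_inv_lt_iff hn0', ENNReal.rpow_natCast] at hn
    exact_mod_cast hn.le
  refine squeeze_zero_norm' hev (tendsto_pow_atTop_nhds_zero_of_lt_one r.2 ?_)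
  exact_mod_cast hr1'

section

attribute [local instance] Matrix.linftyOpNormedRing Matrix.linftyOpNormedAlgebra

theorem matrix_pow_apply_tendsto_zero {J : ℕ} (P : Matrix (Fin J) (Fin J) ℝ)
    (hP : ∀ μ ∈ spectrum ℂ (P.map (Complex.ofReal ·)), ‖μ‖ < 1) (i k : Fin J) :
    Tendsto (fun n : ℕ => (P ^ n) i k) atTop (nhds 0) := by
  have : Nonempty (Fin J) := ⟨i⟩
  have h := tendsto_pow_zero_of_spectrum_norm_lt_one (P.map (Complex.ofReal ·)) hP
  have hik : Tendsto (fun n : ℕ => (P.map (Complex.ofReal ·) ^ n) i k) atTop (nhds 0) :=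
    tendsto_pi_nhds.1 (tendsto_pi_nhds.1 h i) k
  have hpow (n : ℕ) : P.map (Complex.ofReal ·) ^ n = (P ^ n).map (Complex.ofReal ·) :=
    (map_pow Complex.ofRealHom.mapMatrix P n).symm
  have hre := (Complex.continuous_re.tendsto 0).comp hik
  simpa [Function.comp_def, hpow] using hre

end

/-- A bounded family which improves every upper bound `D ≥ 0` to `P D`, where the powers of `P`
vanish in the limit, is nonpositive. -/
theorem family_nonpos_of_bound_improvement {α : Type*} {J : ℕ} (P : Matrix (Fin J) (Fin J) ℝ)
    (hPnn : ∀ i k, 0 ≤ P i k)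
    (hPspec : ∀ μ ∈ spectrum ℂ (P.map (Complex.ofReal ·)), ‖μ‖ < 1)
    (S : Set α) (Φ : α → Fin J → ℝ) (B : Fin J → ℝ) (hB : ∀ q ∈ S, ∀ i, Φ q i ≤ B i)
    (hstep : ∀ D : Fin J → ℝ, (∀ k, 0 ≤ D k) → (∀ q ∈ S, ∀ k, Φ q k ≤ D k) →
      ∀ q ∈ S, ∀ i, Φ q i ≤ ∑ k, P i k * D k) :
    ∀ q ∈ S, ∀ i, Φ q i ≤ 0 := by
  set D₀ : Fin J → ℝ := fun k => |B k|
  have key (n : ℕ) : (∀ k, 0 ≤ (P ^ n).mulVec D₀ k) ∧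
      ∀ q ∈ S, ∀ k, Φ q k ≤ (P ^ n).mulVec D₀ k := by
    induction n with
    | zero =>
      simp only [pow_zero, Matrix.one_mulVec]
      exact ⟨fun k => abs_nonneg _, fun q hq k => (hB q hq k).trans (le_abs_self _)⟩
    | succ n ih =>
      rw [pow_succ', ← Matrix.mulVec_mulVec]
      refine ⟨fun k => ?_, hstep _ ih.1 ih.2⟩
      rw [Matrix.mulVec, dotProduct]
      exact Finset.sum_nonneg fun l _ => mul_nonneg (hPnn k l) (ih.1 l)
  intro q hq i
  have hlim : Tendsto (fun n : ℕ => (P ^ n).mulVec D₀ i) atTop (nhds 0) := by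
    have := tendsto_finsetSum (Finset.univ : Finset (Fin J)) fun k _ =>
      (matrix_pow_apply_tendsto_zero P hPspec i k).mul_const (D₀ k)
    simpa [Matrix.mulVec, dotProduct] using this
  exact ge_of_tendsto' hlim fun n => (key n).2 q hq i

namespace SolvesSkorohod

variable {J : ℕ} {P : Matrix (Fin J) (Fin J) ℝ} {x y z x' y' z' : ℝ → Fin J → ℝ}

theorem eq_add_sub_sum (h : SolvesSkorohod J (1 - P) x y z) {t : ℝ} (ht : 0 ≤ t) (i : Fin J) :
    z t i = x t i + y t i - ∑ k, P i k * y t k := by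
  rw [h.2.2.1 t ht i]
  simp [sub_mul, Finset.sum_sub_distrib, Matrix.one_apply, add_sub_assoc]

theorem z_nonneg {R : Matrix (Fin J) (Fin J) ℝ} (h : SolvesSkorohod J R x y z) {t : ℝ}
    (ht : 0 ≤ t) (i : Fin J) : 0 ≤ z t i :=
  h.2.2.2.1 t ht i

theorem y_zero {R : Matrix (Fin J) (Fin J) ℝ} (h : SolvesSkorohod J R x y z) (i : Fin J) :
    y 0 i = 0 :=
  h.2.2.2.2.1 i

theorem y_mono {R : Matrix (Fin J) (Fin J) ℝ} (h : SolvesSkorohod J R x y z) (i : Fin J)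
    {s t : ℝ} (hs : 0 ≤ s) (hst : s ≤ t) : y s i ≤ y t i :=
  h.2.2.2.2.2.1 i s t hs hst

theorem y_nonneg {R : Matrix (Fin J) (Fin J) ℝ} (h : SolvesSkorohod J R x y z) (i : Fin J)
    {t : ℝ} (ht : 0 ≤ t) : 0 ≤ y t i :=
  (h.y_zero i).ge.trans (h.y_mono i le_rfl ht)

/-- The regulator `y i` does not increase on `[s, t]` after the last zero of `z i` there. -/
theorem y_eq_or_exists_zero {R : Matrix (Fin J) (Fin J) ℝ} (h : SolvesSkorohod J R x y z)
    (i : Fin J) {s t : ℝ} (hs : 0 ≤ s) (hst : s ≤ t) :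
    y t i = y s i ∨ ∃ r ∈ Icc s t, z r i = 0 ∧ y t i = y r i := by
  have hsub : Icc s t ⊆ Ici 0 := fun r hr => hs.trans hr.1
  have hpos {r : ℝ} (hr : r ∈ Icc s t) (hne : z r i ≠ 0) : 0 < z r i :=
    lt_of_le_of_ne (h.z_nonneg (hsub hr) i) hne.symm
  by_cases hz : ∃ r ∈ Icc s t, z r i = 0
  · right
    have hclosed : IsClosed (Icc s t ∩ (fun r => z r i) ⁻¹' {0}) :=
      ((h.2.1 i).mono hsub).preimage_isClosed_of_isClosed isClosed_Icc isClosed_singleton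
    have hcomp : IsCompact (Icc s t ∩ (fun r => z r i) ⁻¹' {0}) :=
      isCompact_Icc.of_isClosed_subset hclosed inter_subset_left
    obtain ⟨r, ⟨hr, hr0⟩, hrmax⟩ := hcomp.exists_isGreatest hz
    refine ⟨r, hr, hr0, ?_⟩
    rcases hr.2.eq_or_lt with rfl | hrt
    · rfl
    have hconst : ∀ u ∈ Ioc r t, y u i = y t i := fun u hu =>
      (h.2.2.2.2.2.2 i u t (hs.trans (hr.1.trans hu.1.le)) hu.2 fun q hq =>
        hpos ⟨hr.1.trans (hu.1.le.trans hq.1), hq.2⟩ fun hq0 =>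
          (hu.1.trans_le hq.1).not_ge
            (hrmax ⟨⟨hr.1.trans (hu.1.le.trans hq.1), hq.2⟩, hq0⟩)).symm
    have hcont : Tendsto (fun u => y u i) (nhdsWithin r (Ioi r)) (nhds (y r i)) :=
      ((h.1 i) r (hsub hr)).mono_left
        (nhdsWithin_mono r fun u hu => mem_Ici.2 ((hsub hr).trans (le_of_lt hu)))
    refine tendsto_nhds_unique (tendsto_const_nhds.congr' ?_) hcont
    filter_upwards [Ioc_mem_nhdsGT hrt] with u hu using (hconst u hu).symm
  · left
    push Not at hz
    exact h.2.2.2.2.2.2 i s t hs hst fun r hr => hpos hr (hz r hr)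

/-- Minimality of the regulator among feasible nondecreasing controls. -/
theorem y_le_of_feasible (hPnn : ∀ i k, 0 ≤ P i k)
    (hPspec : ∀ μ ∈ spectrum ℂ (P.map (Complex.ofReal ·)), ‖μ‖ < 1)
    (h : SolvesSkorohod J (1 - P) x y z) (u : ℝ → Fin J → ℝ) (hu0 : ∀ i, 0 ≤ u 0 i)
    (hu : ∀ i, ∀ s t : ℝ, 0 ≤ s → s ≤ t → u s i ≤ u t i)
    (hfeas : ∀ t : ℝ, 0 ≤ t → ∀ i, 0 ≤ x t i + u t i - ∑ k, P i k * u t k)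
    {T : ℝ} (hT : 0 ≤ T) (i : Fin J) : y T i ≤ u T i := by
  have hunn {t : ℝ} (ht : 0 ≤ t) (i : Fin J) : 0 ≤ u t i := (hu0 i).trans (hu i 0 t le_rfl ht)
  have := family_nonpos_of_bound_improvement P hPnn hPspec (Icc 0 T)
    (fun t i => y t i - u t i) (fun i => y T i)
    (fun t ht i => by linarith [h.y_mono i ht.1 ht.2, hunn ht.1 i]) ?_ T ⟨hT, le_rfl⟩ i
  · linarith
  intro D hD hle t ht i
  have hPD : 0 ≤ ∑ k, P i k * D k := Finset.sum_nonneg fun k _ => mul_nonneg (hPnn i k) (hD k)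
  rcases h.y_eq_or_exists_zero i le_rfl ht.1 with heq | ⟨r, hr, hr0, heq⟩
  · rw [h.y_zero] at heq
    linarith [hunn ht.1 i]
  have hz := h.eq_add_sub_sum hr.1 i
  have hsum : ∑ k, P i k * y r k - ∑ k, P i k * u r k ≤ ∑ k, P i k * D k := by
    rw [← Finset.sum_sub_distrib]
    refine Finset.sum_le_sum fun k _ => ?_
    rw [← mul_sub]
    exact mul_le_mul_of_nonneg_left (hle r ⟨hr.1, hr.2.trans ht.2⟩ k) (hPnn i k)
  linarith [hfeas r hr.1 i, hu i r t hr.1 hr.2]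

/-- Decreasing the increments of the driving path increases the increments of the regulator. -/
theorem increments_le (hPnn : ∀ i k, 0 ≤ P i k)
    (hPspec : ∀ μ ∈ spectrum ℂ (P.map (Complex.ofReal ·)), ‖μ‖ < 1)
    (h : SolvesSkorohod J (1 - P) x y z) (h' : SolvesSkorohod J (1 - P) x' y' z')
    (h0 : ∀ i, x' 0 i ≤ x 0 i)
    (hmono : ∀ i, ∀ s t : ℝ, 0 ≤ s → s ≤ t → x s i - x' s i ≤ x t i - x' t i)
    {s t : ℝ} (hs : 0 ≤ s) (hst : s ≤ t) (i : Fin J) :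
    y' s i - y s i ≤ y' t i - y t i := by
  have := family_nonpos_of_bound_improvement P hPnn hPspec
    {q : ℝ × ℝ | 0 ≤ q.1 ∧ q.1 ≤ q.2 ∧ q.2 ≤ t}
    (fun q i => (y' q.1 i - y q.1 i) - (y' q.2 i - y q.2 i)) (fun i => y t i)
    (fun q hq i => by
      linarith [h'.y_mono i hq.1 hq.2.1, h.y_nonneg i hq.1, h.y_mono i (hq.1.trans hq.2.1) hq.2.2])
    ?_ (s, t) ⟨hs, hst, le_rfl⟩ i
  · linarith
  intro D hD hle q hq i
  obtain ⟨hq0, hqq, hqt⟩ := hq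
  have hPD : 0 ≤ ∑ k, P i k * D k := Finset.sum_nonneg fun k _ => mul_nonneg (hPnn i k) (hD k)
  have hsum {p r : ℝ} (hp : 0 ≤ p) (hpr : p ≤ r) (hr : r ≤ t) :
      (∑ k, P i k * y' p k - ∑ k, P i k * y p k) - (∑ k, P i k * y' r k - ∑ k, P i k * y r k)
        ≤ ∑ k, P i k * D k := by
    simp only [← Finset.sum_sub_distrib, ← mul_sub]
    exact Finset.sum_le_sum fun k _ =>
      mul_le_mul_of_nonneg_left (hle (p, r) ⟨hp, hpr, hr⟩ k) (hPnn i k)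
  rcases h.y_eq_or_exists_zero i hq0 hqq with heq | ⟨r, hr, hr0, heq⟩
  · linarith [h'.y_mono i hq0 hqq]
  have hrnn : 0 ≤ r := hq0.trans hr.1
  have hz := h.eq_add_sub_sum hrnn i
  have hz' := h'.eq_add_sub_sum hrnn i
  have hznn := h'.z_nonneg hrnn i
  have hym := h'.y_mono i hrnn hr.2
  rcases h'.y_eq_or_exists_zero i le_rfl hq0 with heq' | ⟨p, hp, hp0, heq'⟩
  · rw [h'.y_zero] at heq'
    have := hsum le_rfl hrnn (hr.2.trans hqt)
    simp only [h.y_zero, h'.y_zero, mul_zero, Finset.sum_const_zero] at this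
    linarith [h.y_nonneg i hq0, h0 i, hmono i 0 r le_rfl hrnn]
  · have := hsum hp.1 (hp.2.trans hr.1) (hr.2.trans hqt)
    linarith [h.eq_add_sub_sum hp.1 i, h'.eq_add_sub_sum hp.1 i, h.z_nonneg hp.1 i,
      h.y_mono i hp.1 hp.2, hmono i p r hp.1 (hp.2.trans hr.1)]

end SolvesSkorohod

/-- (Lemma 5.3: fixed-point characterization of the derivative `b`.)  Under the hypotheses of
Theorem 4.1 (`P` nonnegative, zero diagonal, spectral radius `< 1`, `R = E − P`, `(y,z)` the
Skorohod solution for `x`, `(y^{ε,j}, z^{ε,j})` the one for `x − ε t e_j`, and `a`, `b` the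
left-derivative limits), for all `i`, `j` and `t ≥ 0`,
`b_i^j(t) = sup{ δ_i^j s + Σ_k P_i^k b_k^j(s) : s ∈ [0,t], z_i(s) = 0 }`,
with the convention `sup ∅ = 0`. -/
theorem derivative_fixed_point_characterization
    (J : ℕ) (P : Matrix (Fin J) (Fin J) ℝ)
    (hPnn : ∀ i k, 0 ≤ P i k) (hPdiag : ∀ i, P i i = 0)
    (hPspec : ∀ μ ∈ spectrum ℂ (P.map (Complex.ofReal ·)), ‖μ‖ < 1)
    (R : Matrix (Fin J) (Fin J) ℝ) (hR : R = 1 - P)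
    (x y z : ℝ → Fin J → ℝ) (hx : ∀ i, ContinuousOn (fun t => x t i) (Set.Ici 0))
    (hxyz : SolvesSkorohod J R x y z)
    (yE zE : ℝ → Fin J → ℝ → Fin J → ℝ)
    (hE : ∀ ε > (0 : ℝ), ∀ j : Fin J,
      SolvesSkorohod J R (fun t i => x t i - ε * t * (if i = j then 1 else 0))
        (yE ε j) (zE ε j))
    (a b : ℝ → Fin J → Fin J → ℝ)
    (ha : ∀ (i j : Fin J), ∀ t ≥ (0 : ℝ),
      Filter.Tendsto (fun ε => (z t i - zE ε j t i) / ε)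
        (nhdsWithin 0 (Set.Ioi 0)) (nhds (a t i j)))
    (hb : ∀ (i j : Fin J), ∀ t ≥ (0 : ℝ),
      Filter.Tendsto (fun ε => -((y t i - yE ε j t i) / ε))
        (nhdsWithin 0 (Set.Ioi 0)) (nhds (b t i j))) :
    ∀ (i j : Fin J), ∀ t ≥ (0 : ℝ),
      b t i j = sSup ((fun s => (if i = j then s else 0) + ∑ k, P i k * b s k j) ''
        {s | s ∈ Set.Icc 0 t ∧ z s i = 0}) := by
  subst hR
  intro i j t ht
  have hinc {ε : ℝ} (hε : 0 < ε) {s u : ℝ} (hs : 0 ≤ s) (hsu : s ≤ u) (k : Fin J) :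
      yE ε j s k - y s k ≤ yE ε j u k - y u k := by
    refine hxyz.increments_le hPnn hPspec (hE ε hε j) (fun i => by simp) (fun i p q _ hpq => ?_)
      hs hsu k
    have := mul_le_mul_of_nonneg_left hpq hε.le
    split_ifs <;> linarith
  set β : ℝ → ℝ → Fin J → ℝ := fun ε s k => (yE ε j s k - y s k) / ε with hβ
  have hβlim (k : Fin J) {s : ℝ} (hs : 0 ≤ s) :
      Tendsto (fun ε => β ε s k) (nhdsWithin 0 (Ioi 0)) (nhds (b s k j)) :=
    (hb k j s hs).congr fun ε => by simp only [hβ]; ring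
  have hβnn {ε : ℝ} (hε : 0 < ε) {s : ℝ} (hs : 0 ≤ s) (k : Fin J) : 0 ≤ β ε s k := by
    have := hinc hε le_rfl hs k
    rw [(hE ε hε j).y_zero, hxyz.y_zero, sub_zero] at this
    exact div_nonneg this hε.le
  have hmulβ {ε : ℝ} (hε : 0 < ε) (s : ℝ) (k : Fin J) : ε * β ε s k = yE ε j s k - y s k :=
    mul_div_cancel₀ _ hε.ne'
  have hβmono {ε ε' : ℝ} (hε : 0 < ε) (hεε' : ε ≤ ε') {s : ℝ} (hs : 0 ≤ s) (k : Fin J) :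
      β ε s k ≤ β ε' s k := by
    have hε' : 0 < ε' := hε.trans_le hεε'
    obtain ⟨l, hl⟩ : ∃ l, l = ε / ε' := ⟨_, rfl⟩
    have hl0 : 0 ≤ l := hl ▸ div_nonneg hε.le hε'.le
    have hl1 : 0 ≤ 1 - l := sub_nonneg.2 (hl ▸ (div_le_one hε').2 hεε')
    have hlε : l * ε' = ε := by simp [hl, hε'.ne']
    have hmin := (hE ε hε j).y_le_of_feasible hPnn hPspec
      (fun s k => (1 - l) * y s k + l * yE ε' j s k)
      (fun k => by simp [hxyz.y_zero, (hE ε' hε' j).y_zero])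
      (fun k p q hp hpq => add_le_add
        (mul_le_mul_of_nonneg_left (hxyz.y_mono k hp hpq) hl1)
        (mul_le_mul_of_nonneg_left ((hE ε' hε' j).y_mono k hp hpq) hl0)) ?_ hs k
    · rw [← mul_le_mul_iff_right₀ hε, hmulβ hε, ← hlε, mul_assoc, hmulβ hε', hlε]
      linarith
    -- The convex combination of the two regulators is feasible.
    intro p hp k
    have hz := mul_nonneg hl1 (hxyz.z_nonneg hp k)
    have hz' := mul_nonneg hl0 ((hE ε' hε' j).z_nonneg hp k)
    rw [hxyz.eq_add_sub_sum hp] at hz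
    rw [(hE ε' hε' j).eq_add_sub_sum hp] at hz'
    have hsum : ∑ m, P k m * ((1 - l) * y p m + l * yE ε' j p m)
        = (1 - l) * ∑ m, P k m * y p m + l * ∑ m, P k m * yE ε' j p m := by
      rw [Finset.mul_sum, Finset.mul_sum, ← Finset.sum_add_distrib]
      exact Finset.sum_congr rfl fun m _ => by ring
    rw [hsum, ← hlε]
    linarith
  have hble {ε : ℝ} (hε : 0 < ε) {s : ℝ} (hs : 0 ≤ s) (k : Fin J) : b s k j ≤ β ε s k := by
    refine le_of_tendsto (hβlim k hs) ?_
    filter_upwards [Ioc_mem_nhdsGT hε] with ε' hε' using hβmono hε'.1 hε'.2 hs k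
  have hbnn {s : ℝ} (hs : 0 ≤ s) (k : Fin J) : 0 ≤ b s k j := by
    refine ge_of_tendsto (hβlim k hs) ?_
    filter_upwards [self_mem_nhdsWithin] with ε hε using hβnn hε hs k
  set F : ℝ → ℝ → ℝ := fun ε s => (if i = j then s else 0) + ∑ k, P i k * β ε s k with hF
  have hFlim {s : ℝ} (hs : 0 ≤ s) : Tendsto (fun ε => F ε s) (nhdsWithin 0 (Ioi 0))
      (nhds ((if i = j then s else 0) + ∑ k, P i k * b s k j)) :=
    tendsto_const_nhds.add (tendsto_finsetSum _ fun k _ => (hβlim k hs).const_mul _)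
  have hFmono {ε ε' : ℝ} (hε : 0 < ε) (hεε' : ε ≤ ε') {s : ℝ} (hs : 0 ≤ s) :
      F ε s ≤ F ε' s :=
    add_le_add le_rfl (Finset.sum_le_sum fun k _ =>
      mul_le_mul_of_nonneg_left (hβmono hε hεε' hs k) (hPnn i k))
  have hFcont {ε : ℝ} (hε : 0 < ε) : ContinuousOn (F ε) (Ici 0) := by
    refine ContinuousOn.add (by split_ifs <;> fun_prop) (continuousOn_finsetSum _ fun k _ => ?_)
    exact continuousOn_const.mul ((((hE ε hε j).1 k).sub (hxyz.1 k)).div_const ε)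
  have hFdiff {ε : ℝ} (hε : 0 < ε) {s : ℝ} (hs : 0 ≤ s) :
      (yE ε j s i - zE ε j s i) - (y s i - z s i) = ε * F ε s := by
    have hsum : ε * ∑ k, P i k * β ε s k = ∑ k, P i k * yE ε j s k - ∑ k, P i k * y s k := by
      rw [Finset.mul_sum, ← Finset.sum_sub_distrib]
      exact Finset.sum_congr rfl fun k _ => by rw [mul_left_comm, hmulβ hε, mul_sub]
    rw [(hE ε hε j).eq_add_sub_sum hs, hxyz.eq_add_sub_sum hs, hF]
    simp only [mul_add, hsum]
    split_ifs <;> ring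
  set V : Set ℝ := (fun s => (if i = j then s else 0) + ∑ k, P i k * b s k j) ''
    {s | s ∈ Icc 0 t ∧ z s i = 0}
  have hVle : ∀ v ∈ V, v ≤ b t i j := by
    rintro _ ⟨s, ⟨hs, hzs⟩, rfl⟩
    refine le_of_tendsto_of_tendsto (hFlim hs.1) (hβlim i ht) ?_
    filter_upwards [self_mem_nhdsWithin] with ε hε
    rw [← mul_le_mul_iff_right₀ hε, hmulβ hε]
    linarith [hFdiff hε hs.1, hinc hε hs.1 hs.2 i, (hE ε hε j).z_nonneg hs.1 i]
  have hSnn : 0 ≤ sSup V := by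
    refine Real.sSup_nonneg ?_
    rintro _ ⟨s, ⟨hs, -⟩, rfl⟩
    refine add_nonneg (by split_ifs; exacts [hs.1, le_rfl]) ?_
    exact Finset.sum_nonneg fun k _ => mul_nonneg (hPnn i k) (hbnn hs.1 k)
  refine le_antisymm ?_ (Real.sSup_le hVle (hbnn ht i))
  by_contra! hlt
  have hbpos : 0 < b t i j := hSnn.trans_lt hlt
  have hex {ε : ℝ} (hε : 0 < ε) : ∃ r ∈ Icc 0 t, b t i j ≤ F ε r ∧ z r i ≤ ε * F ε r := by
    have hbε := mul_le_mul_of_nonneg_left (hble hε ht i) hε.le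
    have hpos := mul_pos hε hbpos
    rw [hmulβ hε] at hbε
    rcases (hE ε hε j).y_eq_or_exists_zero i le_rfl ht with heq | ⟨r, hr, hr0, heq⟩
    · rw [(hE ε hε j).y_zero] at heq
      linarith [hxyz.y_nonneg i ht]
    have hd := hFdiff hε hr.1
    have hym := hxyz.y_mono i hr.1 hr.2
    refine ⟨r, hr, (mul_le_mul_iff_right₀ hε).1 ?_, by linarith⟩
    linarith [hxyz.z_nonneg hr.1 i]
  let e : ℕ → ℝ := fun n => 1 / ((n : ℝ) + 1)
  have he0 (n : ℕ) : 0 < e n := Nat.one_div_pos_of_nat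
  have he1 (n : ℕ) : e n ≤ 1 := (div_le_one (by positivity)).2 (by simp)
  have helim : Tendsto e atTop (nhds 0) := tendsto_one_div_add_atTop_nhds_zero_nat
  choose r hr hrF hrz using fun n => hex (he0 n)
  obtain ⟨q, hq, φ, hφ, hlim⟩ := isCompact_Icc.tendsto_subseq hr
  have hwithin : Tendsto (r ∘ φ) atTop (nhdsWithin q (Ici 0)) :=
    tendsto_nhdsWithin_iff.2 ⟨hlim, Eventually.of_forall fun n => (hr (φ n)).1⟩
  have heφ : Tendsto (fun n => e (φ n)) atTop (nhds 0) := helim.comp hφ.tendsto_atTop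
  have hFq {ε : ℝ} (hε : 0 < ε) :
      Tendsto (fun n => F ε (r (φ n))) atTop (nhds (F ε q)) :=
    ((hFcont hε) q hq.1).tendsto.comp hwithin
  have hzq : z q i = 0 := by
    refine le_antisymm ?_ (hxyz.z_nonneg hq.1 i)
    have hz : Tendsto (fun n => z (r (φ n)) i) atTop (nhds (z q i)) :=
      ((hxyz.2.1 i) q hq.1).tendsto.comp hwithin
    have hbound := heφ.mul (hFq one_pos)
    rw [zero_mul] at hbound
    refine le_of_tendsto_of_tendsto' hz hbound fun n => (hrz (φ n)).trans ?_
    exact mul_le_mul_of_nonneg_left (hFmono (he0 _) (he1 _) (hr _).1) (he0 _).le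
  have hbF {ε : ℝ} (hε : 0 < ε) : b t i j ≤ F ε q := by
    refine ge_of_tendsto (hFq hε) ?_
    filter_upwards [heφ.eventually_le_const hε] with n hn
    exact (hrF (φ n)).trans (hFmono (he0 _) hn (hr _).1)
  have hbq : b t i j ≤ (if i = j then q else 0) + ∑ k, P i k * b q k j := by
    refine ge_of_tendsto (hFlim hq.1) ?_
    filter_upwards [self_mem_nhdsWithin] with ε hε using hbF hε
  exact hlt.not_ge (hbq.trans (le_csSup ⟨_, hVle⟩ ⟨q, ⟨hq, hzq⟩, rfl⟩))
end

section
/- (Appendix B: the map Λ is a contraction.) Suppose in addition that the maximum row sum η = max_i Σ_j P̃_i^j satisfies η < 1. Then for every T > 0 and all b, b' : [0,∞) → ℝ^{J×J} whose entries are bounded on [0,T], max_{i,j} sup_{0≤t≤T} |Λ(b)_i^j(t) − Λ(b')_i^j(t)| ≤ η · max_{i,j} sup_{0≤t≤T} |b_i^j(t) − b'_i^j(t)|. -/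
open Set

/-- The map `Λ` of Appendix B:
`Λ(b)_i^j(t) = sup_{s ∈ [0,t], z_i(s)=0} [χ_i^j(s) + Σ_k P̃_i^k b_k^j(s)]`, `sup ∅ = 0`. -/
noncomputable def Lam (J : ℕ) (Pt : Matrix (Fin J) (Fin J) ℝ)
    (z : ℝ → Fin J → ℝ) (χ : ℝ → Fin J → Fin J → ℝ)
    (b : ℝ → Fin J → Fin J → ℝ) : ℝ → Fin J → Fin J → ℝ :=
  fun t i j =>
    sSup ((fun s => χ s i j + ∑ k, Pt i k * b s k j) '' {s | s ∈ Set.Icc 0 t ∧ z s i = 0})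

/-- Suprema of uniformly close real functions that are bounded above are close. -/
theorem abs_sSup_image_sub_sSup_image_le {α : Type*} {f g : α → ℝ} {S : Set α} {D : ℝ}
    (hf : BddAbove (f '' S)) (hg : BddAbove (g '' S)) (hD : 0 ≤ D)
    (h : ∀ s ∈ S, |f s - g s| ≤ D) : |sSup (f '' S) - sSup (g '' S)| ≤ D := by
  rcases S.eq_empty_or_nonempty with rfl | hS
  · simpa using hD
  · have hfg : sSup (f '' S) ≤ sSup (g '' S) + D := by
      refine csSup_le (hS.image f) ?_
      rintro _ ⟨s, hs, rfl⟩
      linarith [le_csSup hg (mem_image_of_mem g hs), (abs_le.mp (h s hs)).2]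
    have hgf : sSup (g '' S) ≤ sSup (f '' S) + D := by
      refine csSup_le (hS.image g) ?_
      rintro _ ⟨s, hs, rfl⟩
      linarith [le_csSup hf (mem_image_of_mem f hs), (abs_le.mp (h s hs)).1]
    exact abs_le.mpr ⟨by linarith, by linarith⟩

/-- The set whose supremum defines `Lam` is bounded above. -/
theorem bddAbove_Lam_image {J : ℕ} {Pt : Matrix (Fin J) (Fin J) ℝ} (hPtnn : ∀ i k, 0 ≤ Pt i k)
    (z : ℝ → Fin J → ℝ) {χ : ℝ → Fin J → Fin J → ℝ}
    (hχmono : ∀ i j, ∀ s t : ℝ, 0 ≤ s → s ≤ t → χ s i j ≤ χ t i j)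
    {T : ℝ} {b : ℝ → Fin J → Fin J → ℝ}
    (hb : ∀ i j, ∃ M : ℝ, ∀ t ∈ Set.Icc (0 : ℝ) T, |b t i j| ≤ M)
    (i j : Fin J) {t : ℝ} (ht : t ≤ T) :
    BddAbove ((fun s => χ s i j + ∑ k, Pt i k * b s k j) ''
      {s | s ∈ Set.Icc 0 t ∧ z s i = 0}) := by
  choose M hM using hb
  refine ⟨χ t i j + ∑ k, Pt i k * M k j, ?_⟩
  rintro _ ⟨s, ⟨⟨hs0, hst⟩, -⟩, rfl⟩
  exact add_le_add (hχmono i j s t hs0 hst) (Finset.sum_le_sum fun k _ =>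
    mul_le_mul_of_nonneg_left ((le_abs_self _).trans (hM k j s ⟨hs0, hst.trans ht⟩))
      (hPtnn i k))

/-- (Appendix B: the map `Λ` is a contraction.)  If the maximum row sum
`η = max_i Σ_j P̃_i^j` of the nonnegative matrix `P̃` is less than one, then for every `T > 0`
and all `b, b'` with entries bounded on `[0,T]`,
`max_{i,j} sup_{0≤t≤T} |Λ(b)_i^j(t) − Λ(b')_i^j(t)| ≤ η · max_{i,j} sup_{0≤t≤T} |b_i^j(t) − b'_i^j(t)|`
(stated here via arbitrary uniform bounds `C` on `|b − b'|`). -/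
theorem Lam_contraction
    (J : ℕ) (hJ : 1 ≤ J)
    (Pt : Matrix (Fin J) (Fin J) ℝ) (hPtnn : ∀ i k, 0 ≤ Pt i k)
    (z : ℝ → Fin J → ℝ) (hzc : ∀ i, ContinuousOn (fun t => z t i) (Set.Ici 0))
    (hznn : ∀ t ≥ (0 : ℝ), ∀ i, 0 ≤ z t i)
    (χ : ℝ → Fin J → Fin J → ℝ)
    (hχc : ∀ i j, ContinuousOn (fun t => χ t i j) (Set.Ici 0))
    (hχnn : ∀ t ≥ (0 : ℝ), ∀ i j, 0 ≤ χ t i j)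
    (hχmono : ∀ i j, ∀ s t : ℝ, 0 ≤ s → s ≤ t → χ s i j ≤ χ t i j)
    (η : ℝ)
    (hη : η = Finset.univ.sup' (Finset.univ_nonempty_iff.mpr ⟨⟨0, hJ⟩⟩)
      (fun i => ∑ j, Pt i j))
    (hη1 : η < 1)
    (T : ℝ) (hT : 0 < T)
    (b b' : ℝ → Fin J → Fin J → ℝ)
    (hbbd : ∀ i j, ∃ M : ℝ, ∀ t ∈ Set.Icc (0 : ℝ) T, |b t i j| ≤ M)
    (hb'bd : ∀ i j, ∃ M : ℝ, ∀ t ∈ Set.Icc (0 : ℝ) T, |b' t i j| ≤ M) :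
    ∀ C : ℝ, (∀ i j, ∀ t ∈ Set.Icc (0 : ℝ) T, |b t i j - b' t i j| ≤ C) →
      ∀ i j, ∀ t ∈ Set.Icc (0 : ℝ) T,
        |Lam J Pt z χ b t i j - Lam J Pt z χ b' t i j| ≤ η * C := by
  intro C hC i j t ht
  have hC0 : 0 ≤ C := (abs_nonneg _).trans (hC i j t ht)
  have hrow : ∑ k, Pt i k ≤ η := by
    rw [hη]
    exact Finset.le_sup' (fun i => ∑ j, Pt i j) (Finset.mem_univ i)
  have hη0 : 0 ≤ η := (Finset.sum_nonneg fun k _ => hPtnn i k).trans hrow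
  refine abs_sSup_image_sub_sSup_image_le (bddAbove_Lam_image hPtnn z hχmono hbbd i j ht.2)
    (bddAbove_Lam_image hPtnn z hχmono hb'bd i j ht.2) (mul_nonneg hη0 hC0) ?_
  rintro s ⟨⟨hs0, hst⟩, -⟩
  calc |(χ s i j + ∑ k, Pt i k * b s k j) - (χ s i j + ∑ k, Pt i k * b' s k j)|
      = |∑ k, Pt i k * (b s k j - b' s k j)| := by
        simp only [mul_sub, Finset.sum_sub_distrib, add_sub_add_left_eq_sub]
    _ ≤ ∑ k, |Pt i k * (b s k j - b' s k j)| := Finset.abs_sum_le_sum_abs _ _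
    _ ≤ ∑ k, Pt i k * C := Finset.sum_le_sum fun k _ => by
        rw [abs_mul, abs_of_nonneg (hPtnn i k)]
        exact mul_le_mul_of_nonneg_left (hC k j s ⟨hs0, hst.trans ht.2⟩) (hPtnn i k)
    _ = (∑ k, Pt i k) * C := (Finset.sum_mul _ _ _).symm
    _ ≤ η * C := mul_le_mul_of_nonneg_right hrow hC0
end

section
/- (Lemma 5.5 / Appendix B: boundary property of fixed points.) Suppose b : [0,∞) → ℝ^{J×J} has entries that are nonnegative and nondecreasing in t, and b = Λ(b); set a(t) = χ(t) − R̃ b(t). If z_i(t) = 0 for some i ∈ {1,…,J} and t ≥ 0, then a_i^j(t) = 0 for every j. -/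
open Set

/-- (Lemma 5.5 / Appendix B: boundary property of fixed points.)  Suppose `b` has entries that
are nonnegative and nondecreasing in `t` and `b = Λ(b)`; set `a(t) = χ(t) − R̃ b(t)` where
`R̃ = E − P̃`.  If `z_i(t) = 0` for some `i` and `t ≥ 0`, then `a_i^j(t) = 0` for every `j`. -/
theorem fixed_point_boundary_property
    (J : ℕ) (hJ : 1 ≤ J)
    (Pt : Matrix (Fin J) (Fin J) ℝ) (hPtnn : ∀ i k, 0 ≤ Pt i k)
    (Rt : Matrix (Fin J) (Fin J) ℝ) (hRt : Rt = 1 - Pt)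
    (z : ℝ → Fin J → ℝ) (hzc : ∀ i, ContinuousOn (fun t => z t i) (Set.Ici 0))
    (hznn : ∀ t ≥ (0 : ℝ), ∀ i, 0 ≤ z t i)
    (χ : ℝ → Fin J → Fin J → ℝ)
    (hχc : ∀ i j, ContinuousOn (fun t => χ t i j) (Set.Ici 0))
    (hχnn : ∀ t ≥ (0 : ℝ), ∀ i j, 0 ≤ χ t i j)
    (hχmono : ∀ i j, ∀ s t : ℝ, 0 ≤ s → s ≤ t → χ s i j ≤ χ t i j)
    (b : ℝ → Fin J → Fin J → ℝ)
    (hbnn : ∀ t ≥ (0 : ℝ), ∀ i j, 0 ≤ b t i j)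
    (hbmono : ∀ i j, ∀ s t : ℝ, 0 ≤ s → s ≤ t → b s i j ≤ b t i j)
    (hbfix : ∀ t ≥ (0 : ℝ), ∀ i j, b t i j = Lam J Pt z χ b t i j)
    (a : ℝ → Fin J → Fin J → ℝ)
    (ha : ∀ t i j, a t i j = χ t i j - ∑ k, Rt i k * b t k j) :
    ∀ (i : Fin J), ∀ t ≥ (0 : ℝ), z t i = 0 → ∀ j, a t i j = 0 := by
  intro i t ht hz j
  have hmax : IsGreatest
      ((fun s => χ s i j + ∑ k, Pt i k * b s k j) '' {s | s ∈ Set.Icc 0 t ∧ z s i = 0})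
      (χ t i j + ∑ k, Pt i k * b t k j) := by
    refine ⟨⟨t, ⟨⟨ht, le_rfl⟩, hz⟩, rfl⟩, ?_⟩
    rintro _ ⟨s, ⟨⟨hs0, hst⟩, -⟩, rfl⟩
    exact add_le_add (hχmono i j s t hs0 hst) (Finset.sum_le_sum fun k _ =>
      mul_le_mul_of_nonneg_left (hbmono k j s t hs0 hst) (hPtnn i k))
  have hb : b t i j = χ t i j + ∑ k, Pt i k * b t k j :=
    (hbfix t ht i j).trans hmax.csSup_eq
  have hsum : ∑ k, Rt i k * b t k j = b t i j - ∑ k, Pt i k * b t k j := by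
    simp [hRt, Matrix.one_apply, sub_mul, Finset.sum_sub_distrib]
  rw [ha, hsum, hb]
  ring
end

section
/- (Lemma 5.4 / Appendix B: complementarity between z and b.) Suppose b : [0,∞) → ℝ^{J×J} satisfies b = Λ(b). If 0 ≤ u ≤ v and z_i(s) > 0 for all s ∈ [u,v], then b_i^j(v) = b_i^j(u) for every j; that is, b_i^j increases only at times when z_i is zero (the complementarity condition ∫₀^∞ z(t) db^j(t) = 0 of the augmented Skorohod problem). -/
open Set

/-- (Lemma 5.4 / Appendix B: complementarity between `z` and `b`.)  Suppose `b = Λ(b)`.  If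
`0 ≤ u ≤ v` and `z_i(s) > 0` for all `s ∈ [u,v]`, then `b_i^j(v) = b_i^j(u)` for every `j`;
that is, `b_i^j` increases only at times when `z_i` is zero (the complementarity condition
`∫₀^∞ z(t) db^j(t) = 0` of the augmented Skorohod problem). -/
theorem fixed_point_complementarity
    (J : ℕ) (hJ : 1 ≤ J)
    (Pt : Matrix (Fin J) (Fin J) ℝ) (hPtnn : ∀ i k, 0 ≤ Pt i k)
    (z : ℝ → Fin J → ℝ) (hzc : ∀ i, ContinuousOn (fun t => z t i) (Set.Ici 0))
    (hznn : ∀ t ≥ (0 : ℝ), ∀ i, 0 ≤ z t i)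
    (χ : ℝ → Fin J → Fin J → ℝ)
    (hχc : ∀ i j, ContinuousOn (fun t => χ t i j) (Set.Ici 0))
    (hχnn : ∀ t ≥ (0 : ℝ), ∀ i j, 0 ≤ χ t i j)
    (hχmono : ∀ i j, ∀ s t : ℝ, 0 ≤ s → s ≤ t → χ s i j ≤ χ t i j)
    (b : ℝ → Fin J → Fin J → ℝ)
    (hbfix : ∀ t ≥ (0 : ℝ), ∀ i j, b t i j = Lam J Pt z χ b t i j) :
    ∀ (i : Fin J), ∀ u v : ℝ, 0 ≤ u → u ≤ v →
      (∀ s ∈ Set.Icc u v, 0 < z s i) → ∀ j, b v i j = b u i j := by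
  intro i u v hu huv hpos j
  have zeros_eq : {s | s ∈ Set.Icc 0 v ∧ z s i = 0} = {s | s ∈ Set.Icc 0 u ∧ z s i = 0} := by
    ext s
    constructor
    · rintro ⟨⟨h0, hsv⟩, hz⟩
      refine ⟨⟨h0, ?_⟩, hz⟩
      by_contra! hus
      exact (hpos s ⟨hus.le, hsv⟩).ne' hz
    · rintro ⟨⟨h0, hsu⟩, hz⟩
      exact ⟨⟨h0, hsu.trans huv⟩, hz⟩
  rw [hbfix v (hu.trans huv), hbfix u hu, Lam, Lam, zeros_eq]
end

section
/- (Lemma 5.7: a is an affine shift of χ while z is in the interior of the orthant.) Suppose b : [0,∞) → ℝ^{J×J} satisfies b = Λ(b), and set a(t) = χ(t) − R̃ b(t). If 0 ≤ α ≤ β and z_i(s) > 0 for all i ∈ {1,…,J} and all s ∈ [α,β], then b(t) = b(α) and a(t) = a(α) + χ(t) − χ(α) for all t ∈ [α,β]; in particular, when χ(t) = tE this reads a(t) = a(α) + (t−α)E. -/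
open Set

/-- (Lemma 5.7: `a` is an affine shift of `χ` while `z` is in the interior of the orthant.)
Suppose `b = Λ(b)` and `a(t) = χ(t) − R̃ b(t)` with `R̃ = E − P̃`.  If `0 ≤ α ≤ β` and
`z_i(s) > 0` for all `i` and all `s ∈ [α,β]`, then `b(t) = b(α)` and
`a(t) = a(α) + χ(t) − χ(α)` for all `t ∈ [α,β]`. -/
theorem a_affine_in_interior
    (J : ℕ) (hJ : 1 ≤ J)
    (Pt : Matrix (Fin J) (Fin J) ℝ) (hPtnn : ∀ i k, 0 ≤ Pt i k)
    (Rt : Matrix (Fin J) (Fin J) ℝ) (hRt : Rt = 1 - Pt)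
    (z : ℝ → Fin J → ℝ) (hzc : ∀ i, ContinuousOn (fun t => z t i) (Set.Ici 0))
    (hznn : ∀ t ≥ (0 : ℝ), ∀ i, 0 ≤ z t i)
    (χ : ℝ → Fin J → Fin J → ℝ)
    (hχc : ∀ i j, ContinuousOn (fun t => χ t i j) (Set.Ici 0))
    (hχnn : ∀ t ≥ (0 : ℝ), ∀ i j, 0 ≤ χ t i j)
    (hχmono : ∀ i j, ∀ s t : ℝ, 0 ≤ s → s ≤ t → χ s i j ≤ χ t i j)
    (b : ℝ → Fin J → Fin J → ℝ)
    (hbfix : ∀ t ≥ (0 : ℝ), ∀ i j, b t i j = Lam J Pt z χ b t i j)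
    (a : ℝ → Fin J → Fin J → ℝ)
    (ha : ∀ t i j, a t i j = χ t i j - ∑ k, Rt i k * b t k j)
    (α β : ℝ) (hα : 0 ≤ α) (hαβ : α ≤ β)
    (hpos : ∀ (i : Fin J), ∀ s ∈ Set.Icc α β, 0 < z s i) :
    ∀ t ∈ Set.Icc α β, ∀ i j,
      b t i j = b α i j ∧ a t i j = a α i j + χ t i j - χ α i j := by
  have zeros_eq : ∀ t ∈ Set.Icc α β, ∀ i,
      {s | s ∈ Set.Icc 0 t ∧ z s i = 0} = {s | s ∈ Set.Icc 0 α ∧ z s i = 0} := by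
    intro t ht i
    ext s
    constructor
    · rintro ⟨hs, hzs⟩
      refine ⟨⟨hs.1, le_of_not_gt fun hαs => ?_⟩, hzs⟩
      exact (hpos i s ⟨hαs.le, hs.2.trans ht.2⟩).ne' hzs
    · rintro ⟨hs, hzs⟩
      exact ⟨⟨hs.1, hs.2.trans ht.1⟩, hzs⟩
  have b_eq : ∀ t ∈ Set.Icc α β, ∀ i j, b t i j = b α i j := by
    intro t ht i j
    rw [hbfix t (hα.trans ht.1) i j, hbfix α hα i j]
    simp only [Lam, zeros_eq t ht i]
  intro t ht i j
  refine ⟨b_eq t ht i j, ?_⟩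
  rw [ha t i j, ha α i j]
  simp only [b_eq t ht]
  ring
end

section
/- (Lemma 5.9: jump directions of a.) Suppose b : [0,∞) → ℝ^{J×J} satisfies b = Λ(b) and has entries nonnegative and nondecreasing in t, and set a(t) = χ(t) − R̃ b(t); for t > 0, entrywise left limits b(t⁻) and a(t⁻) exist. Let t > 0, let I ⊆ {1,…,J} be nonempty, and suppose z_k(t) = 0 for all k ∈ I and z_i(t) > 0 for all i ∉ I. Then there exists ε ∈ (0,t] such that b_i^j is constant on (t−ε, t] for every i ∉ I and every j; consequently b_i^j(t) − b_i^j(t⁻) = 0 for all i ∉ I, and for each column j, a^j(t) − a^j(t⁻) = −Σ_{k∈I} R̃^k (b_k^j(t) − b_k^j(t⁻)), where R̃^k denotes the k-th column of R̃. -/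
open Set

open Filter Topology

/-- A function that is monotone on `[0, ∞)` has a left limit at each `t > 0`. -/
theorem tendsto_leftLim_of_monotoneOn_Ici {f : ℝ → ℝ} (hf : MonotoneOn f (Ici 0)) {t : ℝ}
    (ht : 0 < t) : Tendsto f (𝓝[<] t) (𝓝 (Function.leftLim f t)) := by
  have hmono : Monotone fun s => f (max s 0) := fun x y hxy =>
    hf (le_max_right x 0) (le_max_right y 0) (max_le_max_right 0 hxy)
  have hpos : ∀ᶠ s in 𝓝[<] t, 0 < s := nhdsWithin_le_nhds (eventually_gt_nhds ht)
  have hlim : Tendsto f (𝓝[<] t) (𝓝 (Function.leftLim (fun s => f (max s 0)) t)) := by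
    refine (hmono.tendsto_leftLim t).congr' ?_
    filter_upwards [hpos] with s hs
    rw [max_eq_left hs.le]
  rwa [leftLim_eq_of_tendsto hlim]

/-- `Λ(b)_i` does not change between `s` and `t` if `z_i` has no zero in `(s, t]`. -/
theorem Lam_eq_of_forall_ne_zero {J : ℕ} {Pt : Matrix (Fin J) (Fin J) ℝ} {z : ℝ → Fin J → ℝ}
    {χ b : ℝ → Fin J → Fin J → ℝ} {s t : ℝ} {i : Fin J} (hst : s ≤ t)
    (hz : ∀ r ∈ Ioc s t, z r i ≠ 0) (j : Fin J) :
    Lam J Pt z χ b s i j = Lam J Pt z χ b t i j := by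
  have hset : {r | r ∈ Icc 0 s ∧ z r i = 0} = {r | r ∈ Icc 0 t ∧ z r i = 0} := by
    ext r
    refine ⟨fun h => ⟨⟨h.1.1, h.1.2.trans hst⟩, h.2⟩, fun h => ⟨⟨h.1.1, ?_⟩, h.2⟩⟩
    by_contra! hr
    exact hz r ⟨hr, h.1.2⟩ h.2
  simp only [Lam, hset]

/-- (Lemma 5.9: jump directions of `a`.)  Suppose `b = Λ(b)` has entries nonnegative and
nondecreasing, and `a(t) = χ(t) − R̃ b(t)` with `R̃ = E − P̃`; left limits are denoted by
`Function.leftLim`.  Let `t > 0`, let `I ⊆ {1,…,J}` be nonempty, and suppose `z_k(t) = 0` for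
`k ∈ I` and `z_i(t) > 0` for `i ∉ I`.  Then there is `ε ∈ (0,t]` with `b_i^j` constant on
`(t−ε, t]` for `i ∉ I`; consequently `Δb_i^j(t) = 0` for `i ∉ I` and, for each column `j`,
`Δa^j(t) = −Σ_{k∈I} R̃^k Δb_k^j(t)`. -/
theorem jump_directions_of_a
    (J : ℕ) (hJ : 1 ≤ J)
    (Pt : Matrix (Fin J) (Fin J) ℝ) (hPtnn : ∀ i k, 0 ≤ Pt i k)
    (Rt : Matrix (Fin J) (Fin J) ℝ) (hRt : Rt = 1 - Pt)
    (z : ℝ → Fin J → ℝ) (hzc : ∀ i, ContinuousOn (fun t => z t i) (Set.Ici 0))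
    (hznn : ∀ t ≥ (0 : ℝ), ∀ i, 0 ≤ z t i)
    (χ : ℝ → Fin J → Fin J → ℝ)
    (hχc : ∀ i j, ContinuousOn (fun t => χ t i j) (Set.Ici 0))
    (hχnn : ∀ t ≥ (0 : ℝ), ∀ i j, 0 ≤ χ t i j)
    (hχmono : ∀ i j, ∀ s t : ℝ, 0 ≤ s → s ≤ t → χ s i j ≤ χ t i j)
    (b : ℝ → Fin J → Fin J → ℝ)
    (hbnn : ∀ t ≥ (0 : ℝ), ∀ i j, 0 ≤ b t i j)
    (hbmono : ∀ i j, ∀ s t : ℝ, 0 ≤ s → s ≤ t → b s i j ≤ b t i j)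
    (hbfix : ∀ t ≥ (0 : ℝ), ∀ i j, b t i j = Lam J Pt z χ b t i j)
    (a : ℝ → Fin J → Fin J → ℝ)
    (ha : ∀ t i j, a t i j = χ t i j - ∑ k, Rt i k * b t k j)
    (t : ℝ) (ht : 0 < t)
    (I : Finset (Fin J)) (hI : I.Nonempty)
    (hzI : ∀ k ∈ I, z t k = 0) (hzIc : ∀ i ∉ I, 0 < z t i) :
    (∃ ε : ℝ, 0 < ε ∧ ε ≤ t ∧
      ∀ i ∉ I, ∀ (j : Fin J), ∀ s ∈ Set.Ioc (t - ε) t, b s i j = b t i j) ∧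
    (∀ i ∉ I, ∀ (j : Fin J),
      b t i j - Function.leftLim (fun s => b s i j) t = 0) ∧
    (∀ (j i : Fin J),
      a t i j - Function.leftLim (fun s => a s i j) t =
        -∑ k ∈ I, Rt i k * (b t k j - Function.leftLim (fun s => b s k j) t)) := by
  have hconst : ∃ ε : ℝ, 0 < ε ∧ ε ≤ t ∧
      ∀ i ∉ I, ∀ (j : Fin J), ∀ s ∈ Set.Ioc (t - ε) t, b s i j = b t i j := by
    have hev : ∀ᶠ s in 𝓝 t, ∀ i, i ∉ I → 0 < z s i := by
      refine eventually_all.2 fun i => ?_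
      by_cases hi : i ∈ I
      · exact Eventually.of_forall fun _ h => absurd hi h
      · filter_upwards [((hzc i).continuousAt (Ici_mem_nhds ht)).eventually
          (eventually_gt_nhds (hzIc i hi))] with s hs _ using hs
    obtain ⟨δ, hδ, hball⟩ := Metric.eventually_nhds_iff.1 hev
    refine ⟨min δ t, lt_min hδ ht, min_le_right _ _, fun i hi j s hs => ?_⟩
    have hδs : t - s < δ := by linarith [hs.1, min_le_left δ t]
    have hs0 : 0 ≤ s := by linarith [hs.1, min_le_right δ t]
    rw [hbfix s hs0, hbfix t ht.le]
    refine Lam_eq_of_forall_ne_zero hs.2 (fun r hr => (hball ?_ i hi).ne') j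
    rw [Real.dist_eq, abs_lt]
    constructor <;> linarith [hr.1, hr.2]
  have hlim : ∀ k j, Tendsto (fun s => b s k j) (𝓝[<] t)
      (𝓝 (Function.leftLim (fun s => b s k j) t)) := fun k j =>
    tendsto_leftLim_of_monotoneOn_Ici (fun x hx y _ hxy => hbmono k j x y hx hxy) ht
  have hjump : ∀ i ∉ I, ∀ (j : Fin J),
      b t i j - Function.leftLim (fun s => b s i j) t = 0 := by
    intro i hi j
    obtain ⟨ε, hε, -, hb⟩ := hconst
    refine sub_eq_zero.2 (tendsto_nhds_unique ?_ (hlim i j))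
    refine tendsto_const_nhds.congr' ?_
    filter_upwards [Ioo_mem_nhdsLT (sub_lt_self t hε)] with s hs
    exact (hb i hi j s ⟨hs.1, hs.2.le⟩).symm
  refine ⟨hconst, hjump, fun j i => ?_⟩
  have hχlim : Tendsto (fun s => χ s i j) (𝓝[<] t) (𝓝 (χ t i j)) :=
    ((hχc i j).continuousAt (Ici_mem_nhds ht)).mono_left nhdsWithin_le_nhds
  have halim : Tendsto (fun s => a s i j) (𝓝[<] t)
      (𝓝 (χ t i j - ∑ k, Rt i k * Function.leftLim (fun s => b s k j) t)) := by
    simp only [ha]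
    exact hχlim.sub (tendsto_finsetSum _ fun k _ => (hlim k j).const_mul _)
  have hsum : ∑ k ∈ I, Rt i k * (b t k j - Function.leftLim (fun s => b s k j) t) =
      ∑ k, Rt i k * (b t k j - Function.leftLim (fun s => b s k j) t) :=
    Finset.sum_subset (Finset.subset_univ I) fun k _ hk => by rw [hjump k hk j, mul_zero]
  rw [leftLim_eq_of_tendsto halim, ha, hsum]
  simp only [mul_sub, Finset.sum_sub_distrib]
  ring
end

section
/- (Appendix B: uniqueness of the derivative part of the augmented Skorohod problem.) Suppose in addition that P̃ has zeros on the diagonal and spectral radius less than one. Say that a pair (a, b) of functions a, b : [0,∞) → ℝ^{J×J} solves the derivative part of the augmented Skorohod problem if: a(t) = χ(t) − R̃ b(t) for all t ≥ 0; b(0) = 0; every entry b_i^j is nonnegative, nondecreasing and right-continuous; b_i^j(v) = b_i^j(u) whenever 0 ≤ u ≤ v and z_i(s) > 0 for all s ∈ [u,v]; and z_i(t) = 0 implies a_i^j(t) = 0 for all j. If (a, b) and (a', b') both solve the derivative part of the augmented Skorohod problem, then a = a' and b = b'. -/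
open Set

/-- `(a, b)` solves the derivative part of the augmented Skorohod problem associated with the
data `(R̃ = E − P̃, z, χ)`:  `a = χ − R̃ b`; `b(0) = 0`; every entry of `b` is nonnegative,
nondecreasing and right-continuous; each `b_i^j` is constant on intervals where `z_i > 0`; and
`z_i(t) = 0` implies `a_i^j(t) = 0` for all `j`. -/
def SolvesDerivPart (J : ℕ) (Pt : Matrix (Fin J) (Fin J) ℝ)
    (z : ℝ → Fin J → ℝ) (χ : ℝ → Fin J → Fin J → ℝ)
    (a b : ℝ → Fin J → Fin J → ℝ) : Prop :=
  (∀ t ≥ (0 : ℝ), ∀ i j, a t i j = χ t i j - ∑ k, ((1 : Matrix (Fin J) (Fin J) ℝ) - Pt) i k * b t k j) ∧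
  (∀ i j, b 0 i j = 0) ∧
  (∀ t ≥ (0 : ℝ), ∀ i j, 0 ≤ b t i j) ∧
  (∀ i j, ∀ s t : ℝ, 0 ≤ s → s ≤ t → b s i j ≤ b t i j) ∧
  (∀ i j, ∀ t ≥ (0 : ℝ), ContinuousWithinAt (fun s => b s i j) (Set.Ici t) t) ∧
  (∀ (i : Fin J), ∀ u v : ℝ, 0 ≤ u → u ≤ v →
    (∀ s ∈ Set.Icc u v, 0 < z s i) → ∀ j, b v i j = b u i j) ∧
  (∀ (i : Fin J), ∀ t ≥ (0 : ℝ), z t i = 0 → ∀ j, a t i j = 0)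

open Filter Topology NNReal ENNReal in
theorem tendsto_pow_zero_of_spectralRadius_lt_one {A : Type*} [NormedRing A] [NormedAlgebra ℂ A]
    [CompleteSpace A] {x : A} (hx : spectralRadius ℂ x < 1) :
    Tendsto (fun n : ℕ => x ^ n) atTop (𝓝 0) := by
  obtain ⟨r, hxr, hr1⟩ := ENNReal.lt_iff_exists_nnreal_btwn.1 hx
  have hr1 : r < 1 := by exact_mod_cast hr1
  refine squeeze_zero_norm' (a := fun n : ℕ => (r : ℝ) ^ n) ?_
    (tendsto_pow_atTop_nhds_zero_of_lt_one r.coe_nonneg hr1)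
  filter_upwards [(spectrum.pow_nnnorm_pow_one_div_tendsto_nhds_spectralRadius x).eventually_lt_const
    hxr, eventually_gt_atTop 0] with n hn hn0
  have hn' : (n : ℝ) ≠ 0 := by positivity
  have h := ENNReal.rpow_le_rpow hn.le (Nat.cast_nonneg (α := ℝ) n)
  rw [← ENNReal.rpow_mul, one_div_mul_cancel hn', ENNReal.rpow_one, ENNReal.rpow_natCast] at h
  exact_mod_cast h

open Filter Topology Matrix.Norms.Operator in
theorem Matrix.tendsto_pow_mulVec_zero {n : Type*} [Fintype n] [DecidableEq n] [Nonempty n]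
    (P : Matrix n n ℝ) (hP : ∀ μ ∈ spectrum ℂ (P.map (Complex.ofReal ·)), ‖μ‖ < 1) (c : n → ℝ) :
    Tendsto (fun m : ℕ => (P ^ m).mulVec c) atTop (𝓝 0) := by
  have hC : Tendsto (fun m : ℕ => P.map (Complex.ofReal ·) ^ m) atTop (𝓝 0) :=
    tendsto_pow_zero_of_spectralRadius_lt_one
      (spectrum.spectralRadius_lt_of_forall_lt _ (r := 1) fun μ hμ => hP μ hμ)
  have hre : Tendsto (fun m : ℕ => P ^ m) atTop (𝓝 0) := by
    have h := ((continuous_id.matrix_map Complex.continuous_re).tendsto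
      (0 : Matrix n n ℂ)).comp hC
    convert h using 1
    · funext m
      have hm : P.map (Complex.ofReal ·) ^ m = (P ^ m).map (Complex.ofReal ·) :=
        (Matrix.map_pow P Complex.ofRealHom m).symm
      ext i k
      simp [hm]
    · congr 1
  have hcont : Continuous fun M : Matrix n n ℝ => M.mulVec c :=
    continuous_id.matrix_mulVec continuous_const
  simpa [Function.comp_def] using (hcont.tendsto 0).comp hre

theorem ContinuousOn.forall_ne_zero_or_exists_last_zero {f : ℝ → ℝ} {x y : ℝ}
    (hf : ContinuousOn f (Icc x y)) :
    (∀ s ∈ Icc x y, f s ≠ 0) ∨ ∃ s ∈ Icc x y, f s = 0 ∧ ∀ u ∈ Ioc s y, f u ≠ 0 := by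
  by_cases h : (Icc x y ∩ f ⁻¹' {0}).Nonempty
  · right
    have hK : IsCompact (Icc x y ∩ f ⁻¹' {0}) :=
      isCompact_Icc.of_isClosed_subset
        (hf.preimage_isClosed_of_isClosed isClosed_Icc isClosed_singleton) inter_subset_left
    obtain ⟨s, ⟨hs, hs0⟩, hmax⟩ := hK.exists_isGreatest h
    exact ⟨s, hs, hs0, fun u hu hu0 =>
      hu.1.not_ge (hmax ⟨⟨hs.1.trans hu.1.le, hu.2⟩, hu0⟩)⟩
  · left
    exact fun s hs hs0 => h ⟨s, hs, hs0⟩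

namespace SolvesDerivPart

variable {J : ℕ} {Pt : Matrix (Fin J) (Fin J) ℝ} {z : ℝ → Fin J → ℝ}
  {χ a b a' b' : ℝ → Fin J → Fin J → ℝ}

theorem eq_zero_of_forall_pos (h : SolvesDerivPart J Pt z χ a b) {i : Fin J} {t : ℝ}
    (ht : 0 ≤ t) (hz : ∀ s ∈ Icc 0 t, 0 < z s i) (j : Fin J) : b t i j = 0 := by
  obtain ⟨-, h0, -, -, -, hconst, -⟩ := h
  rw [hconst i 0 t le_rfl ht hz j, h0]

theorem eq_of_forall_Ioc_pos (h : SolvesDerivPart J Pt z χ a b) {i : Fin J} {s t : ℝ}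
    (hs : 0 ≤ s) (hst : s ≤ t) (hz : ∀ u ∈ Ioc s t, 0 < z u i) (j : Fin J) :
    b t i j = b s i j := by
  obtain ⟨-, -, -, -, hrc, hconst, -⟩ := h
  rcases hst.eq_or_lt with rfl | hlt
  · rfl
  have hlim := (hrc i j s hs).mono_left (nhdsWithin_mono s Ioi_subset_Ici_self)
  refine tendsto_nhds_unique (Filter.Tendsto.congr' ?_ tendsto_const_nhds) hlim
  filter_upwards [Ioc_mem_nhdsGT hlt] with u hu
  exact hconst i u t (hs.trans hu.1.le) hu.2 (fun v hv => hz v ⟨hu.1.trans_le hv.1, hv.2⟩) j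

theorem eq_of_zero (h : SolvesDerivPart J Pt z χ a b) {i : Fin J} {t : ℝ} (ht : 0 ≤ t)
    (hz : z t i = 0) (j : Fin J) : b t i j = χ t i j + ∑ k, Pt i k * b t k j := by
  obtain ⟨ha, -, -, -, -, -, hzero⟩ := h
  have h1 := ha t ht i j
  rw [hzero i t ht hz j] at h1
  simp only [Matrix.sub_apply, sub_mul, Finset.sum_sub_distrib, Matrix.one_apply, ite_mul,
    one_mul, zero_mul, Finset.sum_ite_eq, Finset.mem_univ, if_true] at h1
  linarith

/-- Any vector bounding the difference of two solutions on `[0, T]` may be improved by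
applying `P̃` to it. -/
theorem abs_sub_le_mulVec (hPt : ∀ i k, 0 ≤ Pt i k)
    (hzc : ∀ i, ContinuousOn (fun t => z t i) (Ici 0)) (hz : ∀ t ≥ (0 : ℝ), ∀ i, 0 ≤ z t i)
    (h : SolvesDerivPart J Pt z χ a b) (h' : SolvesDerivPart J Pt z χ a' b') {T : ℝ} {j : Fin J}
    {c : Fin J → ℝ} (hc : ∀ t ∈ Icc 0 T, ∀ i, |b t i j - b' t i j| ≤ c i) :
    ∀ t ∈ Icc 0 T, ∀ i, |b t i j - b' t i j| ≤ Pt.mulVec c i := by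
  intro t ht i
  have hcnn : ∀ k, 0 ≤ c k := fun k => (abs_nonneg _).trans (hc t ht k)
  rcases ((hzc i).mono Icc_subset_Ici_self).forall_ne_zero_or_exists_last_zero (y := t) with
    hne | ⟨s, hs, hs0, hne⟩
  · have hpos : ∀ s ∈ Icc 0 t, 0 < z s i := fun s hs => (hz s hs.1 i).lt_of_ne' (hne s hs)
    rw [h.eq_zero_of_forall_pos ht.1 hpos, h'.eq_zero_of_forall_pos ht.1 hpos, sub_zero, abs_zero]
    rw [Matrix.mulVec, dotProduct]
    exact Finset.sum_nonneg fun k _ => mul_nonneg (hPt i k) (hcnn k)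
  · have hpos : ∀ u ∈ Ioc s t, 0 < z u i := fun u hu =>
      (hz u (hs.1.trans hu.1.le) i).lt_of_ne' (hne u hu)
    rw [h.eq_of_forall_Ioc_pos hs.1 hs.2 hpos, h'.eq_of_forall_Ioc_pos hs.1 hs.2 hpos,
      h.eq_of_zero hs.1 hs0, h'.eq_of_zero hs.1 hs0, add_sub_add_left_eq_sub,
      ← Finset.sum_sub_distrib]
    refine (Finset.abs_sum_le_sum_abs _ _).trans (Finset.sum_le_sum fun k _ => ?_)
    rw [← mul_sub, abs_mul, abs_of_nonneg (hPt i k)]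
    exact mul_le_mul_of_nonneg_left (hc s ⟨hs.1, hs.2.trans ht.2⟩ k) (hPt i k)

end SolvesDerivPart

/-- (Appendix B: uniqueness of the derivative part of the augmented Skorohod problem.)
`P̃` is nonnegative with zeros on the diagonal and spectral radius less than one, `z` is a
continuous `[0,∞)^J`-valued path, and `χ` is continuous with nonnegative nondecreasing entries.
If `(a, b)` and `(a', b')` both solve the derivative part of the augmented Skorohod problem,
then `a = a'` and `b = b'` on `[0,∞)`. -/
theorem deriv_part_unique
    (J : ℕ) (hJ : 1 ≤ J)
    (Pt : Matrix (Fin J) (Fin J) ℝ) (hPtnn : ∀ i k, 0 ≤ Pt i k)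
    (hPtdiag : ∀ i, Pt i i = 0)
    (hPtspec : ∀ μ ∈ spectrum ℂ (Pt.map (Complex.ofReal ·)), ‖μ‖ < 1)
    (z : ℝ → Fin J → ℝ) (hzc : ∀ i, ContinuousOn (fun t => z t i) (Set.Ici 0))
    (hznn : ∀ t ≥ (0 : ℝ), ∀ i, 0 ≤ z t i)
    (χ : ℝ → Fin J → Fin J → ℝ)
    (hχc : ∀ i j, ContinuousOn (fun t => χ t i j) (Set.Ici 0))
    (hχnn : ∀ t ≥ (0 : ℝ), ∀ i j, 0 ≤ χ t i j)
    (hχmono : ∀ i j, ∀ s t : ℝ, 0 ≤ s → s ≤ t → χ s i j ≤ χ t i j)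
    (a b a' b' : ℝ → Fin J → Fin J → ℝ)
    (hab : SolvesDerivPart J Pt z χ a b)
    (hab' : SolvesDerivPart J Pt z χ a' b') :
    ∀ t ≥ (0 : ℝ), ∀ i j, a t i j = a' t i j ∧ b t i j = b' t i j := by
  have : Nonempty (Fin J) := ⟨⟨0, hJ⟩⟩
  have hb : ∀ t ≥ (0 : ℝ), ∀ i j, b t i j = b' t i j := by
    intro T hT i j
    have hbound : ∀ m : ℕ, ∀ t ∈ Icc 0 T, ∀ i,
        |b t i j - b' t i j| ≤ (Pt ^ m).mulVec (fun k => b T k j + b' T k j) i := by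
      intro m
      induction m with
      | zero =>
        intro t ht k
        obtain ⟨-, -, hnn, hmono, -⟩ := hab
        obtain ⟨-, -, hnn', hmono', -⟩ := hab'
        have := hnn t ht.1 k j
        have := hnn' t ht.1 k j
        have := hmono k j t T ht.1 ht.2
        have := hmono' k j t T ht.1 ht.2
        rw [pow_zero, Matrix.one_mulVec, abs_le]
        constructor <;> linarith
      | succ m ih =>
        rw [pow_succ', ← Matrix.mulVec_mulVec]
        exact hab.abs_sub_le_mulVec hPtnn hzc hznn hab' ih
    have hlim := tendsto_pi_nhds.1
      (Pt.tendsto_pow_mulVec_zero hPtspec fun k => b T k j + b' T k j) i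
    have hle : |b T i j - b' T i j| ≤ 0 :=
      ge_of_tendsto' hlim fun m => hbound m T (right_mem_Icc.2 hT) i
    exact sub_eq_zero.1 (abs_nonpos_iff.1 hle)
  intro t ht i j
  refine ⟨?_, hb t ht i j⟩
  rw [hab.1 t ht, hab'.1 t ht]
  simp only [hb t ht]
end
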